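/- Fix q ∈ (0,2), β ∈ (0,∞) and α ∈ (1,∞), and set β_q := β^{2/q} and α_q := 2α/q. Let μ̃_q be the Borel probability measure on (0,∞) with dμ̃_q(λ) := λ^{−1/2} dμ_q(λ) / ∫₀^∞ λ^{−1/2} dμ_q(λ), let (λ_{ij})_{i,j∈ℤ} be i.i.d. random variables distributed according to μ̃_q, and denote by Ẽ_q the expectation with respect to these conductances. Then for every integer N ≥ 1, Var^{q-SOS}_{N,β,α}[φ(0)] ≤ Ẽ_q[ Var^λ_{N,β_q,α_q}[φ(0)] ]. -/

import Mathlib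

noncomputable section

/-- Configurations of the long-range chain of length `N`: integer-valued height functions
on `ℤ` vanishing outside `{-N, …, N}`. -/
def ChainConfig (N : ℕ) : Type :=
  {φ : ℤ → ℤ // ∀ k : ℤ, (N : ℤ) < |k| → φ k = 0}

/-- Energy `β ∑_{i ≠ j} |φ(i) − φ(j)|^q / |i − j|^α` of a configuration of the long-range
chain with potential exponent `q` and range exponent `α`. -/
def chainEnergy (β α q : ℝ) (φ : ℤ → ℤ) : ℝ :=
  β * ∑' p : ℤ × ℤ,
      if p.1 = p.2 then 0
      else |((φ p.1 - φ p.2 : ℤ) : ℝ)| ^ q / |((p.1 - p.2 : ℤ) : ℝ)| ^ α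

/-- Boltzmann weight of a configuration. -/
def chainWeight (β α q : ℝ) (φ : ℤ → ℤ) : ℝ :=
  Real.exp (-chainEnergy β α q φ)

/-- Partition function of the long-range chain. -/
def chainZ (N : ℕ) (β α q : ℝ) : ℝ :=
  ∑' φ : ChainConfig N, chainWeight β α q φ.val

/-- Mean of the height at the origin. -/
def chainMean (N : ℕ) (β α q : ℝ) : ℝ :=
  (∑' φ : ChainConfig N, ((φ.val 0 : ℤ) : ℝ) * chainWeight β α q φ.val) / chainZ N β α q

/-- Variance of the height at the origin under the long-range chain `μ_{N,β,α}`
(with potential exponent `q`; `q = 2` is the discrete Gaussian chain,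
`q ∈ (0,2)` the `q`-SOS chain). -/
def chainVar (N : ℕ) (β α q : ℝ) : ℝ :=
  (∑' φ : ChainConfig N, ((φ.val 0 : ℤ) : ℝ) ^ 2 * chainWeight β α q φ.val) / chainZ N β α q
    - chainMean N β α q ^ 2

end

noncomputable section

/-- Energy of a configuration of the Gaussian long-range chain equipped with
conductances `lam = (λ_{ij})_{i,j∈ℤ}`:
`β ∑_{i ≠ j} λ_{ij} (φ(i) − φ(j))² / |i − j|^α`. -/
def qchainEnergy (β α : ℝ) (lam : ℤ × ℤ → ℝ) (φ : ℤ → ℤ) : ℝ :=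
  β * ∑' p : ℤ × ℤ,
      if p.1 = p.2 then 0
      else lam p * ((φ p.1 - φ p.2 : ℤ) : ℝ) ^ 2 / |((p.1 - p.2 : ℤ) : ℝ)| ^ α

/-- Boltzmann weight of a configuration of the quenched Gaussian chain. -/
def qchainWeight (β α : ℝ) (lam : ℤ × ℤ → ℝ) (φ : ℤ → ℤ) : ℝ :=
  Real.exp (-qchainEnergy β α lam φ)

/-- Partition function of the quenched Gaussian chain. -/
def qchainZ (N : ℕ) (β α : ℝ) (lam : ℤ × ℤ → ℝ) : ℝ :=
  ∑' φ : ChainConfig N, qchainWeight β α lam φ.val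

/-- Mean of the height at the origin under the quenched Gaussian chain. -/
def qchainMean (N : ℕ) (β α : ℝ) (lam : ℤ × ℤ → ℝ) : ℝ :=
  (∑' φ : ChainConfig N, ((φ.val 0 : ℤ) : ℝ) * qchainWeight β α lam φ.val) /
    qchainZ N β α lam

/-- Variance `Var^λ_{N,β,α}[φ(0)]` of the height at the origin under the Gaussian
long-range chain with conductances `lam`. -/
def qchainVar (N : ℕ) (β α : ℝ) (lam : ℤ × ℤ → ℝ) : ℝ :=
  (∑' φ : ChainConfig N, ((φ.val 0 : ℤ) : ℝ) ^ 2 * qchainWeight β α lam φ.val) /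
      qchainZ N β α lam
    - qchainMean N β α lam ^ 2

end

open MeasureTheory ProbabilityTheory Filter
open scoped ENNReal Topology

theorem summable_pi_prod {n : ℕ} {α : Type*} {f : α → ℝ} (hf0 : ∀ a, 0 ≤ f a) (hf : Summable f) :
    Summable fun v : Fin n → α => ∏ i, f (v i) := by
  induction n with
  | zero => exact Summable.of_finite
  | succ n ih =>
    rw [← (Fin.consEquiv fun _ => α).summable_iff]
    have := hf.mul_of_nonneg ih hf0 fun v => Finset.prod_nonneg fun i _ => hf0 _
    refine this.congr fun p => ?_
    simp [Fin.consEquiv, Fin.prod_univ_succ]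

theorem summable_fintype_prod {S α : Type*} [Fintype S] {f : α → ℝ} (hf0 : ∀ a, 0 ≤ f a)
    (hf : Summable f) : Summable fun v : S → α => ∏ i, f (v i) := by
  rw [← ((Fintype.equivFin S).symm.arrowCongr (Equiv.refl α)).summable_iff]
  refine (summable_pi_prod hf0 hf (n := Fintype.card S)).congr fun v => ?_
  simpa using ((Fintype.equivFin S).prod_comp fun i => f (v i)).symm

theorem summable_one_add_sq_mul_exp_neg_rpow {c q : ℝ} (hc : 0 < c) (hq : 0 < q) :
    Summable fun n : ℤ => (1 + (n : ℝ) ^ 2) * Real.exp (-(c * |(n : ℝ)| ^ q)) := by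
  have hnat : Summable fun n : ℕ => (1 + (n : ℝ) ^ 2) * Real.exp (-(c * |(n : ℝ)| ^ q)) := by
    have h1 := (isLittleO_exp_neg_mul_rpow_atTop hc (-(4 / q))).comp_tendsto
      ((tendsto_rpow_atTop hq).comp tendsto_natCast_atTop_atTop)
    have h2 := h1.bound (c := 1) one_pos
    have hs : Summable fun n : ℕ => 2 * ((n : ℝ) ^ 2)⁻¹ :=
      (Real.summable_nat_pow_inv.2 (by norm_num)).mul_left 2
    refine hs.of_norm_bounded_eventually_nat ?_
    filter_upwards [h2, eventually_ge_atTop 1] with n hn hn1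
    have hn0 : (1 : ℝ) ≤ n := by exact_mod_cast hn1
    have hp : (0 : ℝ) < n := by linarith
    simp only [Function.comp_apply, Real.norm_eq_abs, one_mul, Real.abs_exp] at hn
    rw [← Real.rpow_mul hp.le, show q * -(4 / q) = -4 by field_simp, abs_of_pos (by positivity),
      Real.rpow_neg hp.le, show (4 : ℝ) = (4 : ℕ) by norm_num, Real.rpow_natCast] at hn
    rw [Real.norm_eq_abs, abs_of_pos (by positivity), abs_of_pos hp, ← neg_mul]
    calc (1 + (n : ℝ) ^ 2) * Real.exp (-c * (n : ℝ) ^ q)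
        ≤ (2 * (n : ℝ) ^ 2) * ((n : ℝ) ^ 4)⁻¹ := by
          gcongr
          nlinarith
      _ = 2 * ((n : ℝ) ^ 2)⁻¹ := by field_simp
  refine Summable.of_nat_of_neg hnat ?_
  simpa using hnat

/-- The doubling trick: pairs of vectors `n + m`, `n - m` are the pairs of integer vectors congruent
modulo `2`. -/
theorem tsum_mul_add_sub_nonneg {S : Type*} [Fintype S] {g : (S → ℤ) → ℝ} (hg : Summable g) :
    0 ≤ ∑' p : (S → ℤ) × (S → ℤ), g (p.1 + p.2) * g (p.1 - p.2) := by
  classical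
  let π : (S → ℤ) → (S → ZMod 2) := fun u s => (u s : ZMod 2)
  let gc : (S → ZMod 2) → (S → ℤ) → ℝ := fun c u => if π u = c then g u else 0
  have hgc : ∀ c, Summable (gc c) := fun c => by
    refine Summable.of_norm_bounded hg.norm fun u => ?_
    simp only [gc]
    split_ifs <;> simp
  let F : (S → ℤ) × (S → ℤ) → ℝ := fun p => if π p.1 = π p.2 then g p.1 * g p.2 else 0
  let T : (S → ℤ) × (S → ℤ) → (S → ℤ) × (S → ℤ) := fun p => (p.1 + p.2, p.1 - p.2)
  have hT : Function.Injective T := by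
    intro p p' h
    simp only [T, Prod.mk.injEq] at h
    ext s
    · have h1 := congrFun h.1 s
      have h2 := congrFun h.2 s
      simp only [Pi.add_apply, Pi.sub_apply] at h1 h2
      omega
    · have h1 := congrFun h.1 s
      have h2 := congrFun h.2 s
      simp only [Pi.add_apply, Pi.sub_apply] at h1 h2
      omega
  have hFT : ∀ p, F (T p) = g (p.1 + p.2) * g (p.1 - p.2) := by
    intro p
    have : π (p.1 + p.2) = π (p.1 - p.2) := by
      funext s
      simp [π, sub_eq_add_neg, ZMod.neg_eq_self_mod_two]
    simp [F, T, this]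
  have hsupp : Function.support F ⊆ Set.range T := by
    rintro ⟨u, v⟩ h
    have hπ : π u = π v := by
      by_contra hne
      exact h (by simp [F, hne])
    have hdvd : ∀ s, ∃ k, u s - v s = 2 * k := fun s => by
      have h1 := (ZMod.intCast_eq_intCast_iff_dvd_sub (v s) (u s) 2).1 (congrFun hπ s).symm
      exact h1
    choose k hk using hdvd
    refine ⟨(fun s => v s + k s, k), ?_⟩
    simp only [T, Prod.mk.injEq]
    constructor
    · funext s
      have := hk s
      simp only [Pi.add_apply]
      omega
    · funext s
      simp
  have h1 : ∑' p : (S → ℤ) × (S → ℤ), g (p.1 + p.2) * g (p.1 - p.2) = ∑' p, F p := by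
    rw [← hT.tsum_eq hsupp]
    exact tsum_congr fun p => (hFT p).symm
  have hprod : ∀ c, Summable fun p : (S → ℤ) × (S → ℤ) => gc c p.1 * gc c p.2 := fun c =>
    summable_mul_of_summable_norm (hgc c).norm (hgc c).norm
  have h2 : ∀ p, F p = ∑ c, gc c p.1 * gc c p.2 := by
    intro p
    simp only [F, gc]
    rw [Finset.sum_eq_single (π p.1)]
    · by_cases h : π p.1 = π p.2 <;> simp [h, eq_comm]
    · intro c _ hc
      simp [hc.symm]
    · simp
  rw [h1, tsum_congr h2, Summable.tsum_finsetSum fun c _ => hprod c]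
  refine Finset.sum_nonneg fun c _ => ?_
  rw [← (hgc c).tsum_mul_tsum (hgc c) (hprod c)]
  exact mul_self_nonneg _

theorem ENNReal.mul_add_mul_le_mul_add_mul_of_le {a b c d : ℝ≥0∞} (h : a ≤ b) (h' : c ≤ d) :
    a * d + b * c ≤ a * c + b * d := by
  obtain ⟨e, rfl⟩ := exists_add_of_le h
  obtain ⟨f, rfl⟩ := exists_add_of_le h'
  calc a * (c + f) + (a + e) * c ≤ a * (c + f) + (a + e) * c + e * f := le_self_add
    _ = a * c + (a + e) * (c + f) := by ring

/-- Chebyshev's association inequality. -/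
theorem lintegral_mul_le_of_monotone_of_antitone {X : Type*} [LinearOrder X] [MeasurableSpace X]
    {μ : Measure X} [IsProbabilityMeasure μ] {h V : X → ℝ≥0∞} (hh : Monotone h) (hV : Antitone V)
    (hhm : Measurable h) (hVm : Measurable V) :
    ∫⁻ x, h x * V x ∂μ ≤ (∫⁻ x, h x ∂μ) * ∫⁻ x, V x ∂μ := by
  have key : ∀ x y, h x * V x + h y * V y ≤ h x * V y + h y * V x := by
    intro x y
    rcases le_total x y with hxy | hxy
    · have := ENNReal.mul_add_mul_le_mul_add_mul_of_le (hh hxy) (hV hxy)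
      exact this
    · have := ENNReal.mul_add_mul_le_mul_add_mul_of_le (hh hxy) (hV hxy)
      rw [add_comm, add_comm (h x * V y)]
      exact this
  have hx : ∀ x, h x * V x + ∫⁻ y, h y * V y ∂μ ≤ h x * (∫⁻ y, V y ∂μ) + (∫⁻ y, h y ∂μ) * V x := by
    intro x
    have := lintegral_mono (μ := μ) (key x)
    rwa [lintegral_add_left (by fun_prop), lintegral_add_left (by fun_prop), lintegral_const,
      measure_univ, mul_one, lintegral_const_mul _ hVm, lintegral_mul_const _ hhm] at this
  have := lintegral_mono (μ := μ) hx
  rw [lintegral_add_left (by fun_prop), lintegral_add_left (by fun_prop), lintegral_const,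
      measure_univ, mul_one, lintegral_const_mul _ hVm, lintegral_mul_const _ hhm,
      ← two_mul, ← two_mul] at this
  exact (ENNReal.mul_le_mul_iff_right (by simp) (by simp)).1 this

theorem lmarginal_update_mono {ι : Type*} [DecidableEq ι] {X : ι → Type*}
    [∀ i, MeasurableSpace (X i)] (μ : ∀ i, Measure (X i)) {f : (∀ i, X i) → ℝ≥0∞} {s : Finset ι}
    {i : ι} (hi : i ∉ s) {a b : X i}
    (hab : ∀ x, f (Function.update x i a) ≤ f (Function.update x i b)) (x : ∀ i, X i) :
    (∫⋯∫⁻_s, f ∂μ) (Function.update x i a) ≤ (∫⋯∫⁻_s, f ∂μ) (Function.update x i b) := by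
  refine lintegral_mono fun y => ?_
  have hcomm : ∀ t : X i, Function.updateFinset (Function.update x i t) s y =
      Function.update (Function.updateFinset x s y) i t := by
    intro t
    ext j
    by_cases hj : j = i
    · subst hj
      simp [Function.updateFinset, hi]
    · simp [Function.updateFinset, Function.update_of_ne hj]
  rw [hcomm, hcomm]
  exact hab _

/-- **Harris' inequality** for product measures, with coordinatewise monotonicity. -/
theorem lmarginal_mul_le {ι : Type*} [DecidableEq ι] {X : ι → Type*}
    [∀ i, LinearOrder (X i)] [∀ i, MeasurableSpace (X i)] (μ : ∀ i, Measure (X i))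
    [∀ i, IsProbabilityMeasure (μ i)] {h V : (∀ i, X i) → ℝ≥0∞}
    (hhm : Measurable h) (hVm : Measurable V)
    (hh : ∀ x i, Monotone fun t => h (Function.update x i t))
    (hV : ∀ x i, Antitone fun t => V (Function.update x i t)) (s : Finset ι) (x : ∀ i, X i) :
    (∫⋯∫⁻_s, (fun y => h y * V y) ∂μ) x ≤ (∫⋯∫⁻_s, h ∂μ) x * (∫⋯∫⁻_s, V ∂μ) x := by
  induction s using Finset.induction_on generalizing x with
  | empty => simp
  | insert i s hi ih =>
    rw [lmarginal_insert (fun y => h y * V y) (hhm.mul hVm) hi,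
      lmarginal_insert _ hhm hi, lmarginal_insert _ hVm hi]
    refine (lintegral_mono fun t => ih _).trans ?_
    refine lintegral_mul_le_of_monotone_of_antitone ?_ ?_ ?_ ?_
    · exact fun a b hab => lmarginal_update_mono μ hi (fun y => hh y i hab) x
    · exact fun a b hab => lmarginal_update_mono μ hi (fun y => hV y i hab) x
    · exact (hhm.lmarginal μ).comp (measurable_update x)
    · exact (hVm.lmarginal μ).comp (measurable_update x)

theorem lintegral_pi_mul_le {ι : Type*} [Fintype ι] {X : ι → Type*}
    [∀ i, LinearOrder (X i)] [∀ i, MeasurableSpace (X i)] (μ : ∀ i, Measure (X i))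
    [∀ i, IsProbabilityMeasure (μ i)] [DecidableEq ι] {h V : (∀ i, X i) → ℝ≥0∞}
    (hhm : Measurable h) (hVm : Measurable V)
    (hh : ∀ x i, Monotone fun t => h (Function.update x i t))
    (hV : ∀ x i, Antitone fun t => V (Function.update x i t)) :
    ∫⁻ x, h x * V x ∂(Measure.pi μ) ≤
      (∫⁻ x, h x ∂(Measure.pi μ)) * ∫⁻ x, V x ∂(Measure.pi μ) := by
  have (i : ι) : Nonempty (X i) := (μ i).nonempty_of_neZero
  let x : ∀ i, X i := fun i => Classical.arbitrary _
  rw [lintegral_eq_lmarginal_univ x, lintegral_eq_lmarginal_univ x, lintegral_eq_lmarginal_univ x]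
  exact lmarginal_mul_le μ hhm hVm hh hV _ x

/-- A quadratic form on `ℤ^S` (encoded by the parallelogram law) bounded below by a positive
multiple of the Euclidean one. -/
structure IsCoerciveForm {S : Type*} [Fintype S] (Q : (S → ℤ) → ℝ) : Prop where
  parallelogram : ∀ n m, Q (n + m) + Q (n - m) = 2 * (Q n + Q m)
  coercive : ∃ δ > 0, ∀ n, δ * ∑ s, ((n s : ℤ) : ℝ) ^ 2 ≤ Q n

theorem one_add_sq_coord_le_prod {S : Type*} [Fintype S] (n : S → ℤ) (s : S) :
    1 + ((n s : ℤ) : ℝ) ^ 2 ≤ ∏ s, (1 + ((n s : ℤ) : ℝ) ^ 2) := by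
  classical
  rw [← Finset.mul_prod_erase _ _ (Finset.mem_univ s)]
  refine le_mul_of_one_le_right (by positivity) ?_
  calc (1 : ℝ) = ∏ i ∈ Finset.univ.erase s, (1 : ℝ) := by simp
    _ ≤ _ := Finset.prod_le_prod (fun _ _ => zero_le_one) fun i _ =>
      le_add_of_nonneg_right (sq_nonneg _)

theorem abs_coord_le_prod {S : Type*} [Fintype S] (n : S → ℤ) (s : S) :
    |((n s : ℤ) : ℝ)| ≤ ∏ s, (1 + ((n s : ℤ) : ℝ) ^ 2) := by
  refine le_trans ?_ (one_add_sq_coord_le_prod n s)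
  nlinarith [sq_nonneg (|((n s : ℤ) : ℝ)| - 1), sq_abs ((n s : ℤ) : ℝ)]

theorem sq_coord_le_prod {S : Type*} [Fintype S] (n : S → ℤ) (s : S) :
    ((n s : ℤ) : ℝ) ^ 2 ≤ ∏ s, (1 + ((n s : ℤ) : ℝ) ^ 2) :=
  (le_add_of_nonneg_left zero_le_one).trans (one_add_sq_coord_le_prod n s)

theorem one_le_prod_one_add_sq {S : Type*} [Fintype S] (n : S → ℤ) :
    1 ≤ ∏ s, (1 + ((n s : ℤ) : ℝ) ^ 2) :=
  calc (1 : ℝ) = ∏ _i : S, (1 : ℝ) := by simp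
    _ ≤ _ := Finset.prod_le_prod (fun _ _ => zero_le_one) fun i _ =>
      le_add_of_nonneg_right (sq_nonneg _)

theorem summable_mul_cos {α : Type*} (x : α → ℝ) {f : α → ℝ} (hf : Summable f) :
    Summable fun n => f n * Real.cos (x n) :=
  hf.norm.of_norm_bounded fun n => by
    rw [norm_mul]
    exact mul_le_of_le_one_right (norm_nonneg _) (Real.abs_cos_le_one _)

theorem summable_mul_exp_neg_of_le {S : Type*} [Fintype S] {E f : (S → ℤ) → ℝ} {c q : ℝ}
    (hc : 0 < c) (hq : 0 < q) (hE : ∀ n, c * ∑ s, |((n s : ℤ) : ℝ)| ^ q ≤ E n)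
    (hf : ∀ n, |f n| ≤ ∏ s, (1 + ((n s : ℤ) : ℝ) ^ 2)) :
    Summable fun n => f n * Real.exp (-E n) := by
  have h := summable_fintype_prod (S := S) (fun n : ℤ => by positivity)
    (summable_one_add_sq_mul_exp_neg_rpow hc hq)
  refine h.of_norm_bounded fun n => ?_
  rw [norm_mul, Real.norm_eq_abs, Real.norm_eq_abs, Real.abs_exp, Finset.prod_mul_distrib,
    ← Real.exp_sum, Finset.sum_neg_distrib, ← Finset.mul_sum]
  gcongr
  · exact hf n
  · exact hE n

namespace IsCoerciveForm

variable {S : Type*} [Fintype S] {Q : (S → ℤ) → ℝ}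

theorem summable_mul_exp_neg_half (hQ : IsCoerciveForm Q) {f : (S → ℤ) → ℝ}
    (hf : ∀ n, |f n| ≤ ∏ s, (1 + ((n s : ℤ) : ℝ) ^ 2)) :
    Summable fun n => f n * Real.exp (-(Q n / 2)) := by
  obtain ⟨δ, hδ, h⟩ := hQ.coercive
  refine summable_mul_exp_neg_of_le (half_pos hδ) two_pos (fun n => ?_) hf
  have := h n
  simp only [Real.rpow_two, sq_abs]
  linarith

theorem summable_mul_exp_neg (hQ : IsCoerciveForm Q) {f : (S → ℤ) → ℝ}
    (hf : ∀ n, |f n| ≤ ∏ s, (1 + ((n s : ℤ) : ℝ) ^ 2)) :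
    Summable fun n => f n * Real.exp (-Q n) := by
  obtain ⟨δ, hδ, h⟩ := hQ.coercive
  refine summable_mul_exp_neg_of_le hδ two_pos (fun n => ?_) hf
  simpa only [Real.rpow_two, sq_abs] using h n

theorem summable_exp_neg (hQ : IsCoerciveForm Q) : Summable fun n => Real.exp (-Q n) := by
  simpa using hQ.summable_mul_exp_neg (f := fun _ => 1) fun n => by
    simpa using one_le_prod_one_add_sq n

theorem summable_sq_mul_exp_neg (hQ : IsCoerciveForm Q) (s : S) :
    Summable fun n => ((n s : ℤ) : ℝ) ^ 2 * Real.exp (-Q n) :=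
  hQ.summable_mul_exp_neg fun n => by
    rw [abs_of_nonneg (sq_nonneg _)]
    exact sq_coord_le_prod n s

theorem tsum_exp_neg_pos (hQ : IsCoerciveForm Q) : 0 < ∑' n, Real.exp (-Q n) :=
  hQ.summable_exp_neg.tsum_pos (fun _ => (Real.exp_pos _).le) 0 (Real.exp_pos _)

theorem exp_neg_half_mul (hQ : IsCoerciveForm Q) (n m : S → ℤ) :
    Real.exp (-(Q (n + m) / 2)) * Real.exp (-(Q (n - m) / 2)) =
      Real.exp (-Q n) * Real.exp (-Q m) := by
  rw [← Real.exp_add, ← Real.exp_add]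
  congr 1
  linarith [hQ.parallelogram n m]

/-- The Fourier series of a Gaussian is nonnegative. -/
theorem tsum_exp_neg_mul_cos_nonneg (hQ : IsCoerciveForm Q) (x : (S → ℤ) →+ ℝ) (θ : ℝ) :
    0 ≤ ∑' n, Real.exp (-Q n) * Real.cos (θ * x n) := by
  have hw := hQ.summable_exp_neg
  have hc := summable_mul_cos (fun n => θ * x n) hw
  have hg : Summable fun n => Real.exp (-(Q n / 2)) * Real.cos (θ * x n / 2) :=
    summable_mul_cos _ (by
      simpa using hQ.summable_mul_exp_neg_half (f := fun _ => 1) fun n => by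
        simpa using one_le_prod_one_add_sq n)
  have h := tsum_mul_add_sub_nonneg hg
  have hs1 := summable_mul_of_summable_norm hc.norm hw.norm
  have hs2 := summable_mul_of_summable_norm hw.norm hc.norm
  have key : ∀ p : (S → ℤ) × (S → ℤ),
      Real.exp (-(Q (p.1 + p.2) / 2)) * Real.cos (θ * x (p.1 + p.2) / 2) *
        (Real.exp (-(Q (p.1 - p.2) / 2)) * Real.cos (θ * x (p.1 - p.2) / 2)) =
      2⁻¹ * (Real.exp (-Q p.1) * Real.cos (θ * x p.1) * Real.exp (-Q p.2) +
        Real.exp (-Q p.1) * (Real.exp (-Q p.2) * Real.cos (θ * x p.2))) := by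
    intro p
    have h1 := hQ.exp_neg_half_mul p.1 p.2
    have h2 := Real.cos_add_cos (θ * x p.1) (θ * x p.2)
    rw [← mul_add, ← mul_sub, ← map_add, ← map_sub] at h2
    linear_combination Real.cos (θ * x (p.1 + p.2) / 2) * Real.cos (θ * x (p.1 - p.2) / 2) * h1
      - 2⁻¹ * Real.exp (-Q p.1) * Real.exp (-Q p.2) * h2
  rw [tsum_congr key, tsum_mul_left, hs1.tsum_add hs2, ← hc.tsum_mul_tsum hw hs1,
    ← hw.tsum_mul_tsum hc hs2] at h
  have hZ := hQ.tsum_exp_neg_pos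
  by_contra hneg
  rw [not_le] at hneg
  nlinarith [mul_neg_of_neg_of_pos hneg hZ]

/-- Squared coordinates and cosines of linear forms are negatively correlated. -/
theorem tsum_sq_mul_cos_mul_tsum_le (hQ : IsCoerciveForm Q) (s : S) (x : (S → ℤ) →+ ℝ) (θ : ℝ) :
    (∑' n, ((n s : ℤ) : ℝ) ^ 2 * Real.exp (-Q n) * Real.cos (θ * x n)) * ∑' n, Real.exp (-Q n) ≤
      (∑' n, ((n s : ℤ) : ℝ) ^ 2 * Real.exp (-Q n)) *
        ∑' n, Real.exp (-Q n) * Real.cos (θ * x n) := by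
  have hw := hQ.summable_exp_neg
  have hc := summable_mul_cos (fun n => θ * x n) hw
  have ha := hQ.summable_sq_mul_exp_neg s
  have hb := summable_mul_cos (fun n => θ * x n) ha
  have hg : Summable fun n => ((n s : ℤ) : ℝ) * Real.exp (-(Q n / 2)) * Real.sin (θ * x n / 2) :=
    (hQ.summable_mul_exp_neg_half fun n => abs_coord_le_prod n s).norm.of_norm_bounded fun n => by
      rw [norm_mul]
      exact mul_le_of_le_one_right (norm_nonneg _) (Real.abs_sin_le_one _)
  have h := tsum_mul_add_sub_nonneg hg
  have hs1 := summable_mul_of_summable_norm ha.norm hc.norm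
  have hs2 := summable_mul_of_summable_norm hc.norm ha.norm
  have hs3 := summable_mul_of_summable_norm hb.norm hw.norm
  have hs4 := summable_mul_of_summable_norm hw.norm hb.norm
  have key : ∀ p : (S → ℤ) × (S → ℤ),
      (((p.1 + p.2) s : ℤ) : ℝ) * Real.exp (-(Q (p.1 + p.2) / 2)) *
        Real.sin (θ * x (p.1 + p.2) / 2) *
        ((((p.1 - p.2) s : ℤ) : ℝ) * Real.exp (-(Q (p.1 - p.2) / 2)) *
          Real.sin (θ * x (p.1 - p.2) / 2)) =
      2⁻¹ * ((((p.1 s : ℤ) : ℝ) ^ 2 * Real.exp (-Q p.1) *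
            (Real.exp (-Q p.2) * Real.cos (θ * x p.2)) +
          Real.exp (-Q p.1) * Real.cos (θ * x p.1) *
            (((p.2 s : ℤ) : ℝ) ^ 2 * Real.exp (-Q p.2))) -
        (((p.1 s : ℤ) : ℝ) ^ 2 * Real.exp (-Q p.1) * Real.cos (θ * x p.1) * Real.exp (-Q p.2) +
          Real.exp (-Q p.1) *
            (((p.2 s : ℤ) : ℝ) ^ 2 * Real.exp (-Q p.2) * Real.cos (θ * x p.2)))) := by
    intro p
    have h1 := hQ.exp_neg_half_mul p.1 p.2
    have h2 := Real.cos_sub_cos (θ * x p.1) (θ * x p.2)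
    rw [← mul_add, ← mul_sub, ← map_add, ← map_sub] at h2
    simp only [Pi.add_apply, Pi.sub_apply, Int.cast_add, Int.cast_sub]
    linear_combination (((p.1 s : ℤ) : ℝ) ^ 2 - ((p.2 s : ℤ) : ℝ) ^ 2) *
      (Real.sin (θ * x (p.1 + p.2) / 2) * Real.sin (θ * x (p.1 - p.2) / 2) * h1
        + 2⁻¹ * Real.exp (-Q p.1) * Real.exp (-Q p.2) * h2)
  rw [tsum_congr key, tsum_mul_left, (hs1.add hs2).tsum_sub (hs3.add hs4), hs1.tsum_add hs2,
    hs3.tsum_add hs4, ← ha.tsum_mul_tsum hc hs1, ← hc.tsum_mul_tsum ha hs2,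
    ← hb.tsum_mul_tsum hw hs3, ← hw.tsum_mul_tsum hb hs4] at h
  linarith

end IsCoerciveForm

theorem integral_cos_mul_exp_neg_sq_div {s : ℝ} (hs : 0 < s) (x : ℝ) :
    ∫ θ : ℝ, Real.cos (θ * x) * Real.exp (-(θ ^ 2 / (4 * s))) =
      √(4 * Real.pi * s) * Real.exp (-(s * x ^ 2)) := by
  have hb : 0 < ((1 / (4 * s) : ℝ) : ℂ).re := by
    rw [Complex.ofReal_re]
    positivity
  have h := fourierIntegral_gaussian hb (x : ℂ)
  have hrhs : ((Real.pi : ℂ) / ((1 / (4 * s) : ℝ) : ℂ)) ^ (1 / 2 : ℂ) *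
      Complex.exp (-(x : ℂ) ^ 2 / (4 * ((1 / (4 * s) : ℝ) : ℂ))) =
      ((√(4 * Real.pi * s) * Real.exp (-(s * x ^ 2)) : ℝ) : ℂ) := by
    rw [Complex.ofReal_mul, Complex.ofReal_exp, Real.sqrt_eq_rpow,
      Complex.ofReal_cpow (by positivity)]
    have hs' : (s : ℂ) ≠ 0 := by exact_mod_cast hs.ne'
    congr 2
    · push_cast
      field_simp
    · push_cast
      rfl
    · push_cast
      field_simp
  rw [hrhs] at h
  have hne : ((√(4 * Real.pi * s) * Real.exp (-(s * x ^ 2)) : ℝ) : ℂ) ≠ 0 := by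
    have : 0 < √(4 * Real.pi * s) * Real.exp (-(s * x ^ 2)) := by positivity
    exact_mod_cast this.ne'
  have hint : Integrable fun θ : ℝ => Complex.exp (Complex.I * x * θ) *
      Complex.exp (-((1 / (4 * s) : ℝ) : ℂ) * (θ : ℂ) ^ 2) :=
    Integrable.of_integral_ne_zero (by rw [h]; exact hne)
  have hre := congrArg Complex.re h
  rw [Complex.ofReal_re] at hre
  rw [← hre, ← RCLike.re_eq_complex_re, ← integral_re hint]
  refine integral_congr_ae (ae_of_all _ fun θ => ?_)
  have h1 : Complex.exp (-((1 / (4 * s) : ℝ) : ℂ) * (θ : ℂ) ^ 2) =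
      ((Real.exp (-(θ ^ 2 / (4 * s))) : ℝ) : ℂ) := by
    push_cast
    congr 1
    ring
  have h2 : Complex.I * x * θ = ((θ * x : ℝ) : ℂ) * Complex.I := by
    push_cast
    ring
  simp only [h1, h2, RCLike.re_eq_complex_re, Complex.re_mul_ofReal, Complex.exp_ofReal_mul_I_re]

theorem integrable_exp_neg_sq_div {s : ℝ} (hs : 0 < s) :
    Integrable fun θ : ℝ => Real.exp (-(θ ^ 2 / (4 * s))) := by
  refine (integrable_exp_neg_mul_sq (b := 1 / (4 * s)) (by positivity)).congr
    (ae_of_all _ fun θ => ?_)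
  simp only
  congr 1
  ring

theorem integrable_cos_mul_exp_neg_sq_div {s : ℝ} (hs : 0 < s) (x : ℝ) :
    Integrable fun θ : ℝ => Real.cos (θ * x) * Real.exp (-(θ ^ 2 / (4 * s))) :=
  (integrable_exp_neg_sq_div hs).mono (by fun_prop) (ae_of_all _ fun θ => by
    rw [norm_mul]
    exact mul_le_of_le_one_left (norm_nonneg _) (Real.abs_cos_le_one _))

theorem continuous_tsum_mul_cos {α : Type*} {f : α → ℝ} (hf : Summable f) (x : α → ℝ) :
    Continuous fun θ : ℝ => ∑' n, f n * Real.cos (θ * x n) :=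
  continuous_tsum (fun n => by fun_prop) hf.norm fun n θ => by
    rw [norm_mul]
    exact mul_le_of_le_one_right (norm_nonneg _) (Real.abs_cos_le_one _)

theorem integrable_tsum_mul_cos_mul_exp {α : Type*} {f : α → ℝ} (hf : Summable f) (x : α → ℝ)
    {s : ℝ} (hs : 0 < s) :
    Integrable fun θ : ℝ =>
      (∑' n, f n * Real.cos (θ * x n)) * Real.exp (-(θ ^ 2 / (4 * s))) := by
  refine (((integrable_exp_neg_sq_div hs).const_mul (∑' n, ‖f n‖))).mono
    (((continuous_tsum_mul_cos hf x).mul (by fun_prop)).aestronglyMeasurable)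
    (ae_of_all _ fun θ => ?_)
  rw [norm_mul, norm_mul]
  gcongr
  rw [Real.norm_of_nonneg (tsum_nonneg fun _ => norm_nonneg _)]
  refine tsum_of_norm_bounded hf.norm.hasSum fun n => ?_
  rw [norm_mul]
  exact mul_le_of_le_one_right (norm_nonneg _) (Real.abs_cos_le_one _)

/-- Gaussian weights of a linear form as superpositions of cosines. -/
theorem sqrt_mul_tsum_mul_exp_neg {α : Type*} [Countable α] {f : α → ℝ} (hf : Summable f)
    (x : α → ℝ) {s : ℝ} (hs : 0 < s) :
    √(4 * Real.pi * s) * ∑' n, f n * Real.exp (-(s * x n ^ 2)) =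
      ∫ θ : ℝ, (∑' n, f n * Real.cos (θ * x n)) * Real.exp (-(θ ^ 2 / (4 * s))) := by
  have hI : ∀ n, Integrable fun θ : ℝ =>
      f n * (Real.cos (θ * x n) * Real.exp (-(θ ^ 2 / (4 * s)))) := fun n =>
    (integrable_cos_mul_exp_neg_sq_div hs (x n)).const_mul _
  have hS : Summable fun n => ∫ θ : ℝ,
      ‖f n * (Real.cos (θ * x n) * Real.exp (-(θ ^ 2 / (4 * s))))‖ := by
    refine (hf.norm.mul_right (∫ θ : ℝ, Real.exp (-(θ ^ 2 / (4 * s))))).of_nonneg_of_le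
      (fun n => integral_nonneg fun _ => norm_nonneg _) fun n => ?_
    rw [← integral_const_mul]
    refine integral_mono (hI n).norm ((integrable_exp_neg_sq_div hs).const_mul _) fun θ => ?_
    simp only [norm_mul, Real.norm_eq_abs, Real.abs_exp]
    gcongr
    exact mul_le_of_le_one_left (Real.exp_pos _).le (Real.abs_cos_le_one _)
  have h := integral_tsum_of_summable_integral_norm hI hS
  rw [← tsum_mul_left]
  calc ∑' n, √(4 * Real.pi * s) * (f n * Real.exp (-(s * x n ^ 2)))
      = ∑' n, ∫ θ : ℝ, f n * (Real.cos (θ * x n) * Real.exp (-(θ ^ 2 / (4 * s)))) := by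
        refine tsum_congr fun n => ?_
        rw [integral_const_mul, integral_cos_mul_exp_neg_sq_div hs]
        ring
    _ = _ := by
        rw [h]
        refine integral_congr_ae (ae_of_all _ fun θ => ?_)
        simp only [← tsum_mul_right, mul_assoc]

namespace IsCoerciveForm

variable {S : Type*} [Fintype S] {Q : (S → ℤ) → ℝ}

theorem exp_neg_add (a b : ℝ) : Real.exp (-(a + b)) = Real.exp (-a) * Real.exp (-b) := by
  rw [neg_add, Real.exp_add]

/-- The second moment of a coordinate decreases when the form increases. -/
theorem tsum_sq_add_mul_le (hQ : IsCoerciveForm Q) (s : S) (x : (S → ℤ) →+ ℝ) {t : ℝ}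
    (ht : 0 ≤ t) :
    (∑' n, ((n s : ℤ) : ℝ) ^ 2 * Real.exp (-(Q n + t * x n ^ 2))) * ∑' n, Real.exp (-Q n) ≤
      (∑' n, ((n s : ℤ) : ℝ) ^ 2 * Real.exp (-Q n)) *
        ∑' n, Real.exp (-(Q n + t * x n ^ 2)) := by
  rcases ht.eq_or_lt with rfl | ht
  · simp
  have hpos : 0 < √(4 * Real.pi * t) := by positivity
  have hA := sqrt_mul_tsum_mul_exp_neg (hQ.summable_sq_mul_exp_neg s) x ht
  have hZ := sqrt_mul_tsum_mul_exp_neg hQ.summable_exp_neg x ht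
  have hle : (∫ θ : ℝ, (∑' n, ((n s : ℤ) : ℝ) ^ 2 * Real.exp (-Q n) * Real.cos (θ * x n)) *
      Real.exp (-(θ ^ 2 / (4 * t)))) * ∑' n, Real.exp (-Q n) ≤
      (∑' n, ((n s : ℤ) : ℝ) ^ 2 * Real.exp (-Q n)) *
      ∫ θ : ℝ, (∑' n, Real.exp (-Q n) * Real.cos (θ * x n)) * Real.exp (-(θ ^ 2 / (4 * t))) := by
    rw [← integral_mul_const, ← integral_const_mul]
    refine integral_mono
      ((integrable_tsum_mul_cos_mul_exp (hQ.summable_sq_mul_exp_neg s) x ht).mul_const _)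
      ((integrable_tsum_mul_cos_mul_exp hQ.summable_exp_neg x ht).const_mul _) fun θ => ?_
    have := mul_le_mul_of_nonneg_right (hQ.tsum_sq_mul_cos_mul_tsum_le s x θ)
      (Real.exp_pos (-(θ ^ 2 / (4 * t)))).le
    simp only
    linarith
  rw [← hA, ← hZ] at hle
  simp only [exp_neg_add, ← mul_assoc] at hle ⊢
  nlinarith

/-- `√t Z(Q + t x²)` is nondecreasing in `t`. -/
theorem sqrt_mul_tsum_le (hQ : IsCoerciveForm Q) (x : (S → ℤ) →+ ℝ) {t u : ℝ} (ht : 0 < t)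
    (htu : t ≤ u) :
    √t * ∑' n, Real.exp (-(Q n + t * x n ^ 2)) ≤ √u * ∑' n, Real.exp (-(Q n + u * x n ^ 2)) := by
  have hu := ht.trans_le htu
  have h1 := sqrt_mul_tsum_mul_exp_neg hQ.summable_exp_neg x ht
  have h2 := sqrt_mul_tsum_mul_exp_neg hQ.summable_exp_neg x hu
  have hle : (∫ θ : ℝ, (∑' n, Real.exp (-Q n) * Real.cos (θ * x n)) *
      Real.exp (-(θ ^ 2 / (4 * t)))) ≤
      ∫ θ : ℝ, (∑' n, Real.exp (-Q n) * Real.cos (θ * x n)) * Real.exp (-(θ ^ 2 / (4 * u))) := by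
    refine integral_mono (integrable_tsum_mul_cos_mul_exp hQ.summable_exp_neg x ht)
      (integrable_tsum_mul_cos_mul_exp hQ.summable_exp_neg x hu) fun θ => ?_
    have := hQ.tsum_exp_neg_mul_cos_nonneg x θ
    simp only
    gcongr
  have hsqrt : ∀ r, √(4 * Real.pi * r) = √(4 * Real.pi) * √r := Real.sqrt_mul (by positivity)
  rw [← h1, ← h2, hsqrt, hsqrt, mul_assoc, mul_assoc] at hle
  simp only [exp_neg_add]
  exact le_of_mul_le_mul_left hle (by positivity)

/-- As `IsCoerciveForm.sqrt_mul_tsum_le`, where only `Q + t x²` with `t > 0` is coercive. -/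
theorem sqrt_mul_tsum_le_of_forall_pos (x : (S → ℤ) →+ ℝ)
    (hQ : ∀ t, 0 < t → IsCoerciveForm fun n => Q n + t * x n ^ 2) {t u : ℝ} (ht : 0 < t)
    (htu : t ≤ u) :
    √t * ∑' n, Real.exp (-(Q n + t * x n ^ 2)) ≤ √u * ∑' n, Real.exp (-(Q n + u * x n ^ 2)) := by
  have key : ∀ δ ∈ Set.Ioo 0 t, √(t - δ) * ∑' n, Real.exp (-(Q n + t * x n ^ 2)) ≤
      √(u - δ) * ∑' n, Real.exp (-(Q n + u * x n ^ 2)) := by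
    intro δ hδ
    have h := (hQ δ hδ.1).sqrt_mul_tsum_le x (sub_pos.2 hδ.2) (sub_le_sub_right htu δ)
    have e : ∀ (r : ℝ) (n : S → ℤ), Q n + δ * x n ^ 2 + (r - δ) * x n ^ 2 = Q n + r * x n ^ 2 :=
      fun r n => by ring
    simpa only [e] using h
  have hlim : ∀ r Z : ℝ, Tendsto (fun δ => √(r - δ) * Z) (𝓝[>] 0) (𝓝 (√r * Z)) := by
    intro r Z
    have : Continuous fun δ : ℝ => √(r - δ) * Z := by fun_prop
    simpa using (this.tendsto 0).mono_left nhdsWithin_le_nhds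
  refine le_of_tendsto_of_tendsto (hlim t _) (hlim u _) ?_
  filter_upwards [Ioo_mem_nhdsGT ht] with δ hδ using key δ hδ

/-- A domination of the second moment of a coordinate by its conductance to the boundary. -/
theorem mul_tsum_sq_le (s : S)
    (hQ : ∀ t, 0 < t → IsCoerciveForm fun n => Q n + t * ((n s : ℤ) : ℝ) ^ 2) {a : ℝ}
    (ha : 0 < a) :
    a * ∑' n, ((n s : ℤ) : ℝ) ^ 2 * Real.exp (-(Q n + a * ((n s : ℤ) : ℝ) ^ 2)) ≤
      4 * ∑' n, Real.exp (-(Q n + a * ((n s : ℤ) : ℝ) ^ 2)) := by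
  let x : (S → ℤ) →+ ℝ := (Int.castAddHom ℝ).comp (Pi.evalAddMonoidHom (fun _ => ℤ) s)
  have hx : ∀ n, x n = ((n s : ℤ) : ℝ) := fun n => rfl
  have h := sqrt_mul_tsum_le_of_forall_pos x hQ (half_pos ha) (half_le_self ha.le)
  simp only [hx] at h
  set Z := ∑' n, Real.exp (-(Q n + a * ((n s : ℤ) : ℝ) ^ 2))
  set Y := ∑' n, Real.exp (-(Q n + a / 2 * ((n s : ℤ) : ℝ) ^ 2))
  have hZ : 0 < Z := (hQ a ha).tsum_exp_neg_pos
  have hY : 0 < Y := (hQ _ (half_pos ha)).tsum_exp_neg_pos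
  have hYZ : Y ≤ 2 * Z := by
    have hsq : √a ≤ 2 * √(a / 2) := by
      rw [Real.sqrt_le_left (by positivity), mul_pow, Real.sq_sqrt (by positivity)]
      linarith
    have h0 : 0 < √(a / 2) := by positivity
    have : √(a / 2) * Y ≤ √(a / 2) * (2 * Z) := h.trans (by nlinarith)
    exact le_of_mul_le_mul_left this h0
  have hterm : a * ∑' n, ((n s : ℤ) : ℝ) ^ 2 * Real.exp (-(Q n + a * ((n s : ℤ) : ℝ) ^ 2)) ≤
      2 * Y := by
    rw [← tsum_mul_left, ← tsum_mul_left]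
    refine Summable.tsum_le_tsum (fun n => ?_) (((hQ a ha).summable_sq_mul_exp_neg s).mul_left a)
      ((hQ _ (half_pos ha)).summable_exp_neg.mul_left 2)
    have h1 := Real.add_one_le_exp (a / 2 * ((n s : ℤ) : ℝ) ^ 2)
    have h2 : Real.exp (-(Q n + a / 2 * ((n s : ℤ) : ℝ) ^ 2)) =
        Real.exp (a / 2 * ((n s : ℤ) : ℝ) ^ 2) *
          Real.exp (-(Q n + a * ((n s : ℤ) : ℝ) ^ 2)) := by
      rw [← Real.exp_add]
      congr 1
      ring
    rw [h2, ← mul_assoc, ← mul_assoc]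
    exact mul_le_mul_of_nonneg_right (by linarith) (Real.exp_pos _).le
  linarith

end IsCoerciveForm

/-- The quadratic form `∑ λ_p x_p²` of a network with conductances `λ` and gradients `x`. -/
noncomputable def edgeForm {S ι : Type*} [Fintype ι] (x : ι → (S → ℤ) →+ ℝ) (l : ι → ℝ)
    (n : S → ℤ) : ℝ :=
  ∑ p, l p * x p n ^ 2

/-- The partition function of a Gaussian network. -/
noncomputable def edgeZ {S ι : Type*} [Fintype ι] (x : ι → (S → ℤ) →+ ℝ) (l : ι → ℝ) : ℝ≥0∞ :=
  ∑' n : S → ℤ, ENNReal.ofReal (Real.exp (-edgeForm x l n))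

/-- The unnormalized second moment of a coordinate of a Gaussian network. -/
noncomputable def edgeMoment {S ι : Type*} [Fintype ι] (x : ι → (S → ℤ) →+ ℝ) (s : S)
    (l : ι → ℝ) : ℝ≥0∞ :=
  ∑' n : S → ℤ, ENNReal.ofReal (((n s : ℤ) : ℝ) ^ 2 * Real.exp (-edgeForm x l n))

theorem measurable_edgeForm {S ι : Type*} [Fintype ι] {x : ι → (S → ℤ) →+ ℝ}
    (n : S → ℤ) : Measurable fun l : ι → ℝ => edgeForm x l n := by
  unfold edgeForm
  fun_prop

theorem edgeForm_update {S ι : Type*} [Fintype ι] [DecidableEq ι]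
    {x : ι → (S → ℤ) →+ ℝ} (l : ι → ℝ) (i : ι) (t : ℝ) (n : S → ℤ) :
    edgeForm x (Function.update l i t) n =
      (∑ p ∈ Finset.univ.erase i, l p * x p n ^ 2) + t * x i n ^ 2 := by
  rw [edgeForm, ← Finset.sum_erase_add _ _ (Finset.mem_univ i), Function.update_self]
  congr 1
  refine Finset.sum_congr rfl fun p hp => ?_
  rw [Function.update_of_ne (Finset.ne_of_mem_erase hp)]

theorem forall_update_pos {ι : Type*} [DecidableEq ι] {l : ι → ℝ} {i : ι} {a b : ℝ}
    (h : ∀ p, 0 < Function.update l i a p) (hb : 0 < b) : ∀ p, 0 < Function.update l i b p := by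
  intro p
  by_cases hp : p = i
  · subst hp
    simpa using hb
  · simpa [Function.update_of_ne hp] using h p

section EdgeForm

variable {S ι : Type*} [Fintype S] [Fintype ι] {x : ι → (S → ℤ) →+ ℝ}

theorem measurable_edgeZ : Measurable (edgeZ x) :=
  Measurable.tsum fun n => (measurable_edgeForm n).neg.exp.ennreal_ofReal

theorem measurable_edgeMoment (s : S) : Measurable (edgeMoment x s) :=
  Measurable.tsum fun n =>
    ((measurable_edgeForm n).neg.exp.const_mul _).ennreal_ofReal

theorem edgeZ_eq {l : ι → ℝ} (h : IsCoerciveForm (edgeForm x l)) :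
    edgeZ x l = ENNReal.ofReal (∑' n, Real.exp (-edgeForm x l n)) :=
  (ENNReal.ofReal_tsum_of_nonneg (fun _ => (Real.exp_pos _).le) h.summable_exp_neg).symm

theorem edgeMoment_eq {l : ι → ℝ} (h : IsCoerciveForm (edgeForm x l)) (s : S) :
    edgeMoment x s l =
      ENNReal.ofReal (∑' n, ((n s : ℤ) : ℝ) ^ 2 * Real.exp (-edgeForm x l n)) :=
  (ENNReal.ofReal_tsum_of_nonneg (fun _ => by positivity) (h.summable_sq_mul_exp_neg s)).symm

theorem edgeZ_ne_zero {l : ι → ℝ} (h : IsCoerciveForm (edgeForm x l)) : edgeZ x l ≠ 0 := by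
  rw [edgeZ_eq h, Ne, ENNReal.ofReal_eq_zero, not_le]
  exact h.tsum_exp_neg_pos

theorem edgeZ_ne_top {l : ι → ℝ} (h : IsCoerciveForm (edgeForm x l)) : edgeZ x l ≠ ⊤ := by
  rw [edgeZ_eq h]
  exact ENNReal.ofReal_ne_top

theorem monotone_prod_sqrt_mul_edgeZ [DecidableEq ι]
    (hx : ∀ l : ι → ℝ, (∀ p, 0 < l p) → IsCoerciveForm (edgeForm x l)) (l : ι → ℝ) (i : ι) :
    Monotone fun t => (∏ p, ENNReal.ofReal √(Function.update l i t p)) *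
      edgeZ x (Function.update l i t) := by
  intro a b hab
  simp only
  by_cases ha : ∀ p, 0 < Function.update l i a p
  swap
  · push Not at ha
    obtain ⟨p, hp⟩ := ha
    rw [Finset.prod_eq_zero (Finset.mem_univ p) (by simp [Real.sqrt_eq_zero_of_nonpos hp]),
      zero_mul]
    exact zero_le
  have ha0 : 0 < a := by simpa using ha i
  have hpos : ∀ t, 0 < t → ∀ p, 0 < Function.update l i t p := fun t ht => forall_update_pos ha ht
  have hQ : ∀ t, 0 < t → IsCoerciveForm fun n : S → ℤ =>
      (∑ p ∈ Finset.univ.erase i, l p * x p n ^ 2) + t * x i n ^ 2 := fun t ht => by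
    simpa only [funext (edgeForm_update l i t)] using hx _ (hpos t ht)
  have hprod : ∀ t, ∏ p, ENNReal.ofReal √(Function.update l i t p) =
      (∏ p ∈ Finset.univ.erase i, ENNReal.ofReal √(l p)) * ENNReal.ofReal √t := by
    intro t
    rw [← Finset.prod_erase_mul _ _ (Finset.mem_univ i), Function.update_self]
    congr 1
    refine Finset.prod_congr rfl fun p hp => ?_
    rw [Function.update_of_ne (Finset.ne_of_mem_erase hp)]
  rw [hprod, hprod, mul_assoc, mul_assoc, edgeZ_eq (hx _ (hpos a ha0)),
    edgeZ_eq (hx _ (hpos b (ha0.trans_le hab))), ← ENNReal.ofReal_mul (Real.sqrt_nonneg _),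
    ← ENNReal.ofReal_mul (Real.sqrt_nonneg _)]
  refine mul_le_mul' le_rfl (ENNReal.ofReal_le_ofReal ?_)
  simp only [edgeForm_update]
  exact IsCoerciveForm.sqrt_mul_tsum_le_of_forall_pos (x i) hQ ha0 hab

theorem antitone_edgeMoment_div_edgeZ [DecidableEq ι]
    (hx : ∀ l : ι → ℝ, (∀ p, 0 < l p) → IsCoerciveForm (edgeForm x l)) (s : S) (l : ι → ℝ) (i : ι)
    {a b : ℝ} (hab : a ≤ b) (ha : ∀ p, 0 < Function.update l i a p) :
    edgeMoment x s (Function.update l i b) / edgeZ x (Function.update l i b) ≤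
      edgeMoment x s (Function.update l i a) / edgeZ x (Function.update l i a) := by
  have ha0 : 0 < a := by simpa using ha i
  have hQa := hx _ ha
  have hQb := hx _ (forall_update_pos ha (ha0.trans_le hab))
  rw [edgeZ_eq hQa, edgeZ_eq hQb, edgeMoment_eq hQa, edgeMoment_eq hQb,
    ← ENNReal.ofReal_div_of_pos hQa.tsum_exp_neg_pos,
    ← ENNReal.ofReal_div_of_pos hQb.tsum_exp_neg_pos]
  refine ENNReal.ofReal_le_ofReal ?_
  rw [div_le_div_iff₀ hQb.tsum_exp_neg_pos hQa.tsum_exp_neg_pos]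
  have h := hQa.tsum_sq_add_mul_le s (x i) (sub_nonneg.2 hab)
  have e : ∀ n, edgeForm x (Function.update l i a) n + (b - a) * x i n ^ 2 =
      edgeForm x (Function.update l i b) n := fun n => by
    rw [edgeForm_update, edgeForm_update]
    ring
  simpa only [e] using h

theorem lintegral_pi_edgeMoment_le (μ : ι → Measure ℝ) [∀ i, IsProbabilityMeasure (μ i)]
    (hμ : ∀ i, ∀ᵐ t ∂μ i, 0 < t)
    (hx : ∀ l : ι → ℝ, (∀ p, 0 < l p) → IsCoerciveForm (edgeForm x l)) (s : S) :
    ∫⁻ l, (∏ p, ENNReal.ofReal √(l p)) * edgeMoment x s l ∂(Measure.pi μ) ≤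
      (∫⁻ l, (∏ p, ENNReal.ofReal √(l p)) * edgeZ x l ∂(Measure.pi μ)) *
        ∫⁻ l, edgeMoment x s l / edgeZ x l ∂(Measure.pi μ) := by
  classical
  let V : (ι → ℝ) → ℝ≥0∞ := fun l => if ∀ p, 0 < l p then edgeMoment x s l / edgeZ x l else ⊤
  have hset : MeasurableSet {l : ι → ℝ | ∀ p, 0 < l p} := by
    rw [Set.ofPred_forall]
    exact MeasurableSet.iInter fun p => measurableSet_lt measurable_const (measurable_pi_apply p)
  have hVm : Measurable V :=
    Measurable.ite hset ((measurable_edgeMoment s).div measurable_edgeZ) measurable_const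
  have hhm : Measurable fun l : ι → ℝ => (∏ p, ENNReal.ofReal √(l p)) * edgeZ x l :=
    (Finset.measurable_prod _ fun p _ => by fun_prop).mul measurable_edgeZ
  have hae : ∀ᵐ l ∂(Measure.pi μ), ∀ p, 0 < l p :=
    ae_all_iff.2 fun p => (measurePreserving_eval μ p).quasiMeasurePreserving.ae (hμ p)
  have hV : ∀ l i, Antitone fun t => V (Function.update l i t) := by
    intro l i a b hab
    simp only [V]
    by_cases ha : ∀ p, 0 < Function.update l i a p
    · have ha0 : 0 < a := by simpa using ha i
      rw [if_pos ha, if_pos (forall_update_pos ha (ha0.trans_le hab))]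
      exact antitone_edgeMoment_div_edgeZ hx s l i hab ha
    · rw [if_neg ha]
      exact le_top
  have h := lintegral_pi_mul_le μ hhm hVm (monotone_prod_sqrt_mul_edgeZ hx) hV
  have e1 : ∫⁻ l, (∏ p, ENNReal.ofReal √(l p)) * edgeZ x l * V l ∂(Measure.pi μ) =
      ∫⁻ l, (∏ p, ENNReal.ofReal √(l p)) * edgeMoment x s l ∂(Measure.pi μ) := by
    refine lintegral_congr_ae ?_
    filter_upwards [hae] with l hl
    simp only [V, if_pos hl, mul_assoc]
    rw [ENNReal.mul_div_cancel (edgeZ_ne_zero (hx l hl)) (edgeZ_ne_top (hx l hl))]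
  have e2 : ∫⁻ l, V l ∂(Measure.pi μ) = ∫⁻ l, edgeMoment x s l / edgeZ x l ∂(Measure.pi μ) := by
    refine lintegral_congr_ae ?_
    filter_upwards [hae] with l hl
    simp only [V, if_pos hl]
  rwa [e1, e2] at h

end EdgeForm

/-- A multiple of the tilted measure `λ^{-1/2} dμ(λ)`. -/
noncomputable def tiltedMixing (K : ℝ≥0∞) (μ : Measure ℝ) : Measure ℝ :=
  K • μ.withDensity fun l => ENNReal.ofReal (l ^ (-(1 : ℝ) / 2))

section Mixing

variable {q : ℝ} {μ : Measure ℝ} {K : ℝ≥0∞}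

theorem lintegral_tiltedMixing {f : ℝ → ℝ≥0∞} (hf : Measurable f) :
    ∫⁻ l, f l ∂(tiltedMixing K μ) =
      K * ∫⁻ l, ENNReal.ofReal (l ^ (-(1 : ℝ) / 2)) * f l ∂μ := by
  rw [tiltedMixing, lintegral_smul_measure, smul_eq_mul,
    lintegral_withDensity_eq_lintegral_mul _ (by fun_prop) hf]
  rfl

theorem ae_pos_tiltedMixing (hpos : ∀ᵐ l ∂μ, 0 < l) : ∀ᵐ l ∂(tiltedMixing K μ), 0 < l := by
  have h : tiltedMixing K μ ≪ μ :=
    Measure.AbsolutelyContinuous.smul_left (withDensity_absolutelyContinuous _ _) K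
  exact h.ae_le hpos

theorem ne_zero_of_isProbabilityMeasure_tiltedMixing [IsProbabilityMeasure (tiltedMixing K μ)] :
    K ≠ 0 := by
  rintro rfl
  have := measure_univ (μ := tiltedMixing 0 μ)
  simp [tiltedMixing] at this

theorem ne_top_of_isProbabilityMeasure_tiltedMixing [IsProbabilityMeasure (tiltedMixing K μ)] :
    K ≠ ⊤ := by
  rintro rfl
  have h : (⊤ : ℝ≥0∞) * μ.withDensity (fun l => ENNReal.ofReal (l ^ (-(1 : ℝ) / 2))) Set.univ = 1 :=
    measure_univ (μ := tiltedMixing ⊤ μ)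
  by_cases h0 : μ.withDensity (fun l => ENNReal.ofReal (l ^ (-(1 : ℝ) / 2))) Set.univ = 0
  · simp [h0] at h
  · rw [ENNReal.top_mul h0] at h
    exact ENNReal.top_ne_one h

theorem lintegral_exp_neg_mixing
    (hmix : ∀ x : ℝ, Real.exp (-(|x| ^ q)) = ∫ l, Real.exp (-(l * x ^ 2)) ∂μ) (y : ℝ) :
    ∫⁻ l, ENNReal.ofReal (Real.exp (-(l * y ^ 2))) ∂μ = ENNReal.ofReal (Real.exp (-(|y| ^ q))) := by
  rw [hmix y, ofReal_integral_eq_lintegral_ofReal _ (ae_of_all _ fun _ => (Real.exp_pos _).le)]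
  exact Integrable.of_integral_ne_zero (by rw [← hmix y]; exact (Real.exp_pos _).ne')

theorem lintegral_sqrt_mul_exp_neg_tiltedMixing (hpos : ∀ᵐ l ∂μ, 0 < l)
    (hmix : ∀ x : ℝ, Real.exp (-(|x| ^ q)) = ∫ l, Real.exp (-(l * x ^ 2)) ∂μ) (y : ℝ) :
    ∫⁻ l, ENNReal.ofReal (√l * Real.exp (-(l * y ^ 2))) ∂(tiltedMixing K μ) =
      K * ENNReal.ofReal (Real.exp (-(|y| ^ q))) := by
  rw [lintegral_tiltedMixing (by fun_prop), ← lintegral_exp_neg_mixing hmix]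
  congr 1
  refine lintegral_congr_ae ?_
  filter_upwards [hpos] with l hl
  rw [← ENNReal.ofReal_mul (by positivity), ← mul_assoc, Real.sqrt_eq_rpow, ← Real.rpow_add hl]
  norm_num

theorem lintegral_inv_tiltedMixing_lt_top [IsProbabilityMeasure μ] (hq : 0 < q) (hK : K ≠ ⊤)
    (hpos : ∀ᵐ l ∂μ, 0 < l)
    (hmix : ∀ x : ℝ, Real.exp (-(|x| ^ q)) = ∫ l, Real.exp (-(l * x ^ 2)) ∂μ) :
    ∫⁻ l, ENNReal.ofReal l⁻¹ ∂(tiltedMixing K μ) < ⊤ := by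
  rw [lintegral_tiltedMixing (by fun_prop)]
  refine ENNReal.mul_lt_top hK.lt_top ?_
  have hgamma : ∀ l : ℝ, 0 < l →
      ENNReal.ofReal (l ^ (-(1 : ℝ) / 2)) * ENNReal.ofReal l⁻¹ *
          ENNReal.ofReal (Real.Gamma (3 / 2)) =
        ∫⁻ t in Set.Ioi (0 : ℝ), ENNReal.ofReal (t ^ (1 / 2 : ℝ) * Real.exp (-(l * t))) := by
    intro l hl
    have h := Real.integral_rpow_mul_exp_neg_mul_Ioi (a := 3 / 2) (by norm_num) hl
    rw [show (3 / 2 - 1 : ℝ) = 1 / 2 by norm_num] at h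
    have hG : 0 < Real.Gamma (3 / 2) := Real.Gamma_pos_of_pos (by norm_num)
    rw [← ofReal_integral_eq_lintegral_ofReal, h, ← ENNReal.ofReal_mul (by positivity),
      ← ENNReal.ofReal_mul (by positivity)]
    · congr 2
      rw [one_div, Real.inv_rpow hl.le, ← Real.rpow_neg hl.le, ← Real.rpow_neg_one l,
        ← Real.rpow_add hl]
      norm_num
    · refine Integrable.of_integral_ne_zero ?_
      rw [h]
      positivity
    · filter_upwards [ae_restrict_mem measurableSet_Ioi] with t ht
      have : 0 < t := ht
      positivity
  have hG : ENNReal.ofReal (Real.Gamma (3 / 2)) ≠ 0 := by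
    rw [Ne, ENNReal.ofReal_eq_zero, not_le]
    exact Real.Gamma_pos_of_pos (by norm_num)
  refine ENNReal.lt_top_of_mul_ne_top_left (b := ENNReal.ofReal (Real.Gamma (3 / 2))) ?_ hG
  rw [← lintegral_mul_const _ (by fun_prop)]
  have e1 : ∫⁻ l, ENNReal.ofReal (l ^ (-(1 : ℝ) / 2)) * ENNReal.ofReal l⁻¹ *
        ENNReal.ofReal (Real.Gamma (3 / 2)) ∂μ =
      ∫⁻ l, ∫⁻ t in Set.Ioi (0 : ℝ),
        ENNReal.ofReal (t ^ (1 / 2 : ℝ) * Real.exp (-(l * t))) ∂volume ∂μ := by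
    refine lintegral_congr_ae ?_
    filter_upwards [hpos] with l hl using hgamma l hl
  rw [e1, lintegral_lintegral_swap (by fun_prop)]
  have e2 : ∫⁻ t in Set.Ioi (0 : ℝ), ∫⁻ l,
        ENNReal.ofReal (t ^ (1 / 2 : ℝ) * Real.exp (-(l * t))) ∂μ =
      ∫⁻ t in Set.Ioi (0 : ℝ),
        ENNReal.ofReal (t ^ (1 / 2 : ℝ) * Real.exp (-t ^ (q / 2))) := by
    refine setLIntegral_congr_fun measurableSet_Ioi fun t ht => ?_
    have ht : 0 < t := ht
    have h := lintegral_exp_neg_mixing hmix √t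
    rw [Real.sq_sqrt ht.le, abs_of_nonneg (Real.sqrt_nonneg _), Real.sqrt_eq_rpow,
      ← Real.rpow_mul ht.le, one_div_mul_eq_div] at h
    rw [ENNReal.ofReal_mul (by positivity), ← h, ← lintegral_const_mul _ (by fun_prop)]
    refine lintegral_congr fun l => ?_
    rw [ENNReal.ofReal_mul (by positivity)]
  rw [e2]
  exact (integrableOn_rpow_mul_exp_neg_rpow (by norm_num) (half_pos hq)).lintegral_lt_top.ne

theorem lintegral_one_sub_exp_neg_tiltedMixing_le [IsProbabilityMeasure μ]
    (hpos : ∀ᵐ l ∂μ, 0 < l)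
    (hmix : ∀ x : ℝ, Real.exp (-(|x| ^ q)) = ∫ l, Real.exp (-(l * x ^ 2)) ∂μ) (y : ℝ) :
    ∫⁻ l, ENNReal.ofReal (1 - Real.exp (-(l * y ^ 2))) ∂(tiltedMixing K μ) ≤
      K * ENNReal.ofReal (y ^ 2 + |y| ^ q) := by
  have hint : Integrable (fun l => Real.exp (-(l * y ^ 2))) μ :=
    Integrable.of_integral_ne_zero (by rw [← hmix y]; exact (Real.exp_pos _).ne')
  have hint₁ : Integrable (fun l => 1 - Real.exp (-(l * y ^ 2))) μ := (integrable_const _).sub hint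
  have hint' : Integrable (fun l => y ^ 2 + (1 - Real.exp (-(l * y ^ 2)))) μ :=
    (integrable_const _).add hint₁
  rw [lintegral_tiltedMixing (by fun_prop)]
  gcongr
  calc ∫⁻ l, ENNReal.ofReal (l ^ (-(1 : ℝ) / 2)) * ENNReal.ofReal (1 - Real.exp (-(l * y ^ 2))) ∂μ
      ≤ ∫⁻ l, ENNReal.ofReal (y ^ 2 + (1 - Real.exp (-(l * y ^ 2)))) ∂μ := by
        refine lintegral_mono_ae ?_
        filter_upwards [hpos] with l hl
        rw [← ENNReal.ofReal_mul (by positivity)]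
        refine ENNReal.ofReal_le_ofReal ?_
        have h1 : 1 - Real.exp (-(l * y ^ 2)) ≤ l * y ^ 2 := by
          linarith [Real.add_one_le_exp (-(l * y ^ 2))]
        have h0 : 0 ≤ 1 - Real.exp (-(l * y ^ 2)) := by
          rw [sub_nonneg, Real.exp_le_one_iff, neg_nonpos]
          positivity
        rcases le_total l 1 with hl1 | hl1
        · have h2 : l ^ (-(1 : ℝ) / 2) * l ≤ 1 := by
            nth_rewrite 2 [← Real.rpow_one l]
            rw [← Real.rpow_add hl]
            exact Real.rpow_le_one hl.le hl1 (by norm_num)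
          calc l ^ (-(1 : ℝ) / 2) * (1 - Real.exp (-(l * y ^ 2)))
              ≤ l ^ (-(1 : ℝ) / 2) * (l * y ^ 2) := by gcongr
            _ = (l ^ (-(1 : ℝ) / 2) * l) * y ^ 2 := by ring
            _ ≤ 1 * y ^ 2 := by gcongr
            _ ≤ _ := by linarith
        · have h2 : l ^ (-(1 : ℝ) / 2) ≤ 1 := Real.rpow_le_one_of_one_le_of_nonpos hl1 (by norm_num)
          nlinarith [sq_nonneg y]
    _ = ENNReal.ofReal (∫ l, (y ^ 2 + (1 - Real.exp (-(l * y ^ 2)))) ∂μ) := by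
        rw [ofReal_integral_eq_lintegral_ofReal hint']
        filter_upwards [hpos] with l hl
        have : Real.exp (-(l * y ^ 2)) ≤ 1 := by
          rw [Real.exp_le_one_iff, neg_nonpos]
          positivity
        simp only [Pi.zero_apply]
        nlinarith [sq_nonneg y]
    _ ≤ ENNReal.ofReal (y ^ 2 + |y| ^ q) := by
        refine ENNReal.ofReal_le_ofReal ?_
        rw [integral_add (integrable_const _) hint₁,
          integral_sub (integrable_const _) hint, ← hmix y]
        simp only [integral_const, probReal_univ, one_smul]
        linarith [Real.add_one_le_exp (-(|y| ^ q))]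

/-- Domination of a `q`-SOS network by the annealed Gaussian network. -/
theorem tsum_moment_le_tsum_mul_lintegral [IsProbabilityMeasure (tiltedMixing K μ)]
    (hpos : ∀ᵐ l ∂μ, 0 < l)
    (hmix : ∀ x : ℝ, Real.exp (-(|x| ^ q)) = ∫ l, Real.exp (-(l * x ^ 2)) ∂μ)
    {Ω ι S : Type*} [Fintype ι] [Fintype S] {mΩ : MeasurableSpace Ω} {P : Measure Ω}
    [IsProbabilityMeasure P] {X : ι → Ω → ℝ} (hXm : ∀ p, Measurable (X p)) (hX : iIndepFun X P)
    (hlaw : ∀ p, P.map (X p) = tiltedMixing K μ) {x : ι → (S → ℤ) →+ ℝ}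
    (hx : ∀ l : ι → ℝ, (∀ p, 0 < l p) → IsCoerciveForm (edgeForm x l)) (s : S) :
    ∑' n : S → ℤ, ENNReal.ofReal (((n s : ℤ) : ℝ) ^ 2 * Real.exp (-∑ p, |x p n| ^ q)) ≤
      (∑' n : S → ℤ, ENNReal.ofReal (Real.exp (-∑ p, |x p n| ^ q))) *
        ∫⁻ ω, edgeMoment x s (fun p => X p ω) / edgeZ x (fun p => X p ω) ∂P := by
  have hpi : P.map (fun ω p => X p ω) = Measure.pi fun _ : ι => tiltedMixing K μ := by
    rw [(iIndepFun_iff_map_fun_eq_pi_map fun p => (hXm p).aemeasurable).1 hX]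
    simp only [hlaw]
  have hm : Measurable fun ω p => X p ω := measurable_pi_lambda _ hXm
  have hprodm : Measurable fun l : ι → ℝ => ∏ p, ENNReal.ofReal √(l p) :=
    Finset.measurable_prod _ fun p _ => by fun_prop
  have h := lintegral_pi_edgeMoment_le (fun _ : ι => tiltedMixing K μ)
    (fun _ => ae_pos_tiltedMixing hpos) hx s
  have hmA : Measurable fun l : ι → ℝ => (∏ p, ENNReal.ofReal √(l p)) * edgeMoment x s l :=
    hprodm.mul (measurable_edgeMoment s)
  have hmZ : Measurable fun l : ι → ℝ => (∏ p, ENNReal.ofReal √(l p)) * edgeZ x l :=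
    hprodm.mul measurable_edgeZ
  have hmV : Measurable fun l : ι → ℝ => edgeMoment x s l / edgeZ x l :=
    (measurable_edgeMoment s).div measurable_edgeZ
  rw [← hpi, lintegral_map hmA hm, lintegral_map hmZ hm, lintegral_map hmV hm] at h
  have hexp : ∀ n, ∫⁻ ω, (∏ p, ENNReal.ofReal √(X p ω)) *
      ENNReal.ofReal (Real.exp (-edgeForm x (fun p => X p ω) n)) ∂P =
      K ^ Fintype.card ι * ENNReal.ofReal (Real.exp (-∑ p, |x p n| ^ q)) := by
    intro n
    have hind := hX.comp (fun p l => ENNReal.ofReal (√l * Real.exp (-(l * x p n ^ 2))))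
      fun p => by fun_prop
    have e := lintegral_prod_eq_prod_lintegral_of_indepFun Finset.univ _ hind
      fun p => Measurable.comp (by fun_prop) (hXm p)
    calc _ = ∫⁻ ω, ∏ p, ENNReal.ofReal (√(X p ω) * Real.exp (-(X p ω * x p n ^ 2))) ∂P := by
          refine lintegral_congr fun ω => ?_
          rw [edgeForm, ← Finset.sum_neg_distrib, Real.exp_sum,
            ENNReal.ofReal_prod_of_nonneg fun _ _ => (Real.exp_pos _).le,
            ← Finset.prod_mul_distrib]
          exact Finset.prod_congr rfl fun p _ => (ENNReal.ofReal_mul (Real.sqrt_nonneg _)).symm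
      _ = ∏ p, ∫⁻ ω, ENNReal.ofReal (√(X p ω) * Real.exp (-(X p ω * x p n ^ 2))) ∂P := e
      _ = ∏ p, (K * ENNReal.ofReal (Real.exp (-(|x p n| ^ q)))) := by
          refine Finset.prod_congr rfl fun p _ => ?_
          rw [← lintegral_sqrt_mul_exp_neg_tiltedMixing hpos hmix, ← hlaw p,
            lintegral_map (by fun_prop) (hXm p)]
      _ = _ := by
          rw [Finset.prod_mul_distrib, Finset.prod_const, Finset.card_univ,
            ← ENNReal.ofReal_prod_of_nonneg fun _ _ => (Real.exp_pos _).le, ← Real.exp_sum,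
            Finset.sum_neg_distrib]
  have hmeas : ∀ n, Measurable fun ω => (∏ p, ENNReal.ofReal √(X p ω)) *
      ENNReal.ofReal (Real.exp (-edgeForm x (fun p => X p ω) n)) := fun n =>
    (hprodm.comp hm).mul (((measurable_edgeForm n).comp hm).neg.exp.ennreal_ofReal)
  have hZ : ∫⁻ ω, (∏ p, ENNReal.ofReal √(X p ω)) * edgeZ x (fun p => X p ω) ∂P =
      K ^ Fintype.card ι * ∑' n : S → ℤ, ENNReal.ofReal (Real.exp (-∑ p, |x p n| ^ q)) := by
    simp only [edgeZ, ← ENNReal.tsum_mul_left]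
    rw [lintegral_tsum fun n => (hmeas n).aemeasurable]
    exact tsum_congr hexp
  have hA : ∫⁻ ω, (∏ p, ENNReal.ofReal √(X p ω)) * edgeMoment x s (fun p => X p ω) ∂P =
      K ^ Fintype.card ι * ∑' n : S → ℤ,
        ENNReal.ofReal (((n s : ℤ) : ℝ) ^ 2 * Real.exp (-∑ p, |x p n| ^ q)) := by
    simp only [edgeMoment, ← ENNReal.tsum_mul_left, ENNReal.ofReal_mul (sq_nonneg _),
      mul_left_comm _ (ENNReal.ofReal (_ ^ 2))]
    rw [lintegral_tsum fun n => ((hmeas n).const_mul _).aemeasurable]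
    refine tsum_congr fun n => ?_
    rw [lintegral_const_mul _ (hmeas n), hexp]
  simp only [hZ, hA] at h
  rw [mul_assoc] at h
  have hK0 : K ≠ 0 := ne_zero_of_isProbabilityMeasure_tiltedMixing (μ := μ)
  have hKt : K ≠ ⊤ := ne_top_of_isProbabilityMeasure_tiltedMixing (μ := μ)
  exact (ENNReal.mul_le_mul_iff_right (pow_ne_zero _ hK0) (ENNReal.pow_ne_top hKt)).1 h

end Mixing

theorem exists_pos_mul_sum_le {S : Type*} [Fintype S] {w : S → ℝ} (hw : ∀ s, 0 < w s) :
    ∃ a > 0, ∀ u : S → ℝ, (∀ s, 0 ≤ u s) → a * ∑ s, u s ≤ ∑ s, w s * u s := by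
  obtain ⟨a, ha, hle⟩ : ∃ a > 0, ∀ s, a ≤ w s := by
    rcases isEmpty_or_nonempty S with hS | hS
    · exact ⟨1, one_pos, fun s => isEmptyElim s⟩
    · obtain ⟨s₀, hs₀⟩ := Finite.exists_min w
      exact ⟨_, hw s₀, hs₀⟩
  refine ⟨a, ha, fun u hu => ?_⟩
  rw [Finset.mul_sum]
  exact Finset.sum_le_sum fun s _ => mul_le_mul_of_nonneg_right (hle s) (hu s)

section EdgeForm

variable {S ι : Type*} [Fintype S] [Fintype ι] {x : ι → (S → ℤ) →+ ℝ} {e : S ↪ ι} {c : S → ℝ}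

theorem isCoerciveForm_edgeForm (hc : ∀ s, 0 < c s) (hxe : ∀ s n, x (e s) n = c s * (n s : ℝ))
    {l : ι → ℝ} (hl : ∀ p, 0 < l p) : IsCoerciveForm (edgeForm x l) := by
  obtain ⟨δ, hδ, hδl⟩ := exists_pos_mul_sum_le fun s => mul_pos (hl (e s)) (pow_pos (hc s) 2)
  refine ⟨fun m n => ?_, δ, hδ, fun n => ?_⟩
  · simp only [edgeForm, ← Finset.sum_add_distrib, Finset.mul_sum, map_add, map_sub]
    exact Finset.sum_congr rfl fun p _ => by ring
  · calc δ * ∑ s, ((n s : ℤ) : ℝ) ^ 2 ≤ ∑ s, l (e s) * x (e s) n ^ 2 := by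
          refine (hδl _ fun s => sq_nonneg _).trans_eq (Finset.sum_congr rfl fun s _ => ?_)
          rw [hxe, mul_pow, mul_assoc]
      _ = ∑ p ∈ Finset.univ.map e, l p * x p n ^ 2 := 
          (Finset.sum_map Finset.univ e fun p => l p * x p n ^ 2).symm
      _ ≤ edgeForm x l n := Finset.sum_le_univ_sum_of_nonneg
          fun p => mul_nonneg (hl p).le (sq_nonneg _)

theorem mul_tsum_sq_mul_exp_neg_edgeForm_le (hc : ∀ s, 0 < c s)
    (hxe : ∀ s n, x (e s) n = c s * (n s : ℝ)) {l : ι → ℝ} (hl : ∀ p, 0 < l p) (s : S) :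
    l (e s) * c s ^ 2 * ∑' n : S → ℤ, ((n s : ℤ) : ℝ) ^ 2 * Real.exp (-edgeForm x l n) ≤
      4 * ∑' n : S → ℤ, Real.exp (-edgeForm x l n) := by
  classical
  have hu : ∀ (t : ℝ) (n : S → ℤ), edgeForm x (Function.update l (e s) (t / c s ^ 2)) n =
      (∑ p ∈ Finset.univ.erase (e s), l p * x p n ^ 2) + t * ((n s : ℤ) : ℝ) ^ 2 := by
    intro t n
    rw [edgeForm_update, hxe]
    have := (hc s).ne'
    field_simp
  have hQ : ∀ t > 0, IsCoerciveForm fun n : S → ℤ =>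
      (∑ p ∈ Finset.univ.erase (e s), l p * x p n ^ 2) + t * ((n s : ℤ) : ℝ) ^ 2 := by
    intro t ht
    simp only [← hu]
    refine isCoerciveForm_edgeForm hc hxe fun p => ?_
    rw [Function.update_apply]
    split_ifs
    · have := hc s
      positivity
    · exact hl p
  have hself : ∀ n, edgeForm x l n = (∑ p ∈ Finset.univ.erase (e s), l p * x p n ^ 2) +
      l (e s) * c s ^ 2 * ((n s : ℤ) : ℝ) ^ 2 := by
    intro n
    rw [← hu, mul_div_cancel_right₀ _ (pow_ne_zero 2 (hc s).ne'), Function.update_eq_self]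
  simp only [hself]
  exact IsCoerciveForm.mul_tsum_sq_le s hQ (mul_pos (hl _) (pow_pos (hc s) 2))

end EdgeForm

section InfiniteNetwork

variable {S E : Type*}

theorem sum_emb_le_tsum [Fintype S] {g : E → ℝ} (hg : ∀ p, 0 ≤ g p) (hsum : Summable g)
    (e : S ↪ E) : ∑ s, g (e s) ≤ ∑' p, g p := by
  rw [← Finset.sum_map Finset.univ e g]
  exact hsum.sum_le_tsum _ fun p _ => hg p

theorem tendsto_tsum_mul_exp_neg_sum [Fintype S] {g : E → (S → ℤ) → ℝ} (hg : ∀ p n, 0 ≤ g p n)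
    (hsum : ∀ n, Summable fun p => g p n) {e : S ↪ E} {a r : ℝ} (ha : 0 < a) (hr : 0 < r)
    (hge : ∀ n : S → ℤ, a * ∑ s, |(n s : ℝ)| ^ r ≤ ∑ s, g (e s) n) {f : (S → ℤ) → ℝ}
    (hf : ∀ n, |f n| ≤ ∏ s, (1 + (n s : ℝ) ^ 2)) :
    Tendsto (fun F : Finset E => ∑' n, f n * Real.exp (-∑ p ∈ F, g p n)) atTop
      (𝓝 (∑' n, f n * Real.exp (-∑' p, g p n))) := by
  refine tendsto_tsum_of_dominated_convergence
    (summable_mul_exp_neg_of_le ha hr hge hf).abs (fun n => ?_) ?_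
  · have h : Tendsto (fun F : Finset E => ∑ p ∈ F, g p n) atTop (𝓝 (∑' p, g p n)) :=
      (hsum n).hasSum
    exact ((Real.continuous_exp.tendsto _).comp h.neg).const_mul _
  · filter_upwards [eventually_ge_atTop (Finset.univ.map e)] with F hF n
    rw [Real.norm_eq_abs, abs_mul, abs_mul, Real.abs_exp, Real.abs_exp]
    gcongr
    rw [← Finset.sum_map Finset.univ e fun p => g p n]
    exact Finset.sum_le_sum_of_subset_of_nonneg hF fun p _ _ => hg p n

variable {q : ℝ} {μ : Measure ℝ} {K : ℝ≥0∞} {Ω : Type*} {mΩ : MeasurableSpace Ω} {P : Measure Ω}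
  {X : E → Ω → ℝ}

theorem ae_summable_mul_sq [Countable E] [IsProbabilityMeasure μ] (hK : K ≠ ⊤)
    (hpos : ∀ᵐ l ∂μ, 0 < l)
    (hmix : ∀ x : ℝ, Real.exp (-(|x| ^ q)) = ∫ l, Real.exp (-(l * x ^ 2)) ∂μ)
    (hXm : ∀ p, Measurable (X p)) (hlaw : ∀ p, P.map (X p) = tiltedMixing K μ)
    (hXpos : ∀ᵐ ω ∂P, ∀ p, 0 < X p ω) {y : E → ℝ}
    (hy : Summable fun p => |y p| ^ q) (hy2 : Summable fun p => y p ^ 2) :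
    ∀ᵐ ω ∂P, Summable fun p => X p ω * y p ^ 2 := by
  have hm : ∀ p, Measurable fun ω => ENNReal.ofReal (1 - Real.exp (-(X p ω * y p ^ 2))) := by
    intro p
    have := hXm p
    fun_prop
  have hfin : ∫⁻ ω, ∑' p, ENNReal.ofReal (1 - Real.exp (-(X p ω * y p ^ 2))) ∂P ≠ ⊤ := by
    rw [lintegral_tsum fun p => (hm p).aemeasurable]
    have hle : ∀ p, ∫⁻ ω, ENNReal.ofReal (1 - Real.exp (-(X p ω * y p ^ 2))) ∂P ≤
        K * ENNReal.ofReal (y p ^ 2 + |y p| ^ q) := by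
      intro p
      refine le_trans (le_of_eq ?_) (lintegral_one_sub_exp_neg_tiltedMixing_le hpos hmix (y p))
      rw [← hlaw p, lintegral_map (by fun_prop) (hXm p)]
    refine ne_top_of_le_ne_top ?_ (ENNReal.tsum_le_tsum hle)
    rw [ENNReal.tsum_mul_left]
    exact ENNReal.mul_ne_top hK (hy2.add hy).tsum_ofReal_ne_top
  filter_upwards [ae_lt_top (Measurable.tsum hm) hfin, hXpos] with ω hω hω0
  have hxy : ∀ p, 0 ≤ X p ω * y p ^ 2 := fun p => mul_nonneg (hω0 p).le (sq_nonneg _)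
  have h1 : ∀ p, 0 ≤ 1 - Real.exp (-(X p ω * y p ^ 2)) := fun p => by
    rw [sub_nonneg, Real.exp_le_one_iff, neg_nonpos]
    exact hxy p
  have hs : Summable fun p => 1 - Real.exp (-(X p ω * y p ^ 2)) := by
    refine (ENNReal.summable_toReal hω.ne).congr fun p => ?_
    exact ENNReal.toReal_ofReal (h1 p)
  refine Summable.of_norm_bounded_eventually (hs.mul_left 2) ?_
  filter_upwards [hs.tendsto_cofinite_zero.eventually_lt_const (show (0 : ℝ) < 1 / 2 by norm_num)]
    with p hp
  rw [Real.norm_eq_abs, abs_of_nonneg (hxy p)]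
  set t := X p ω * y p ^ 2
  have h2 : t + 1 ≤ Real.exp t := Real.add_one_le_exp t
  have h3 : Real.exp (-t) * Real.exp t = 1 := by rw [← Real.exp_add]; simp
  have h4 : 0 < Real.exp (-t) := Real.exp_pos _
  nlinarith [hxy p]

/-- Domination of an infinite `q`-SOS network by the annealed Gaussian network. -/
theorem tsum_moment_le_tsum_mul_integral [Fintype S] [Countable E]
    [IsProbabilityMeasure μ] [IsProbabilityMeasure (tiltedMixing K μ)] [IsProbabilityMeasure P]
    (hq : 0 < q)
    (hpos : ∀ᵐ l ∂μ, 0 < l)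
    (hmix : ∀ x : ℝ, Real.exp (-(|x| ^ q)) = ∫ l, Real.exp (-(l * x ^ 2)) ∂μ)
    (hXm : ∀ p, Measurable (X p)) (hX : iIndepFun X P)
    (hlaw : ∀ p, P.map (X p) = tiltedMixing K μ) {x : E → (S → ℤ) →+ ℝ} {e : S ↪ E} {c : S → ℝ}
    (hc : ∀ s, 0 < c s) (hxe : ∀ s n, x (e s) n = c s * (n s : ℝ))
    (hx : ∀ n, Summable fun p => |x p n| ^ q) (hx2 : ∀ n, Summable fun p => x p n ^ 2) (s : S) :
    ∑' n : S → ℤ, (n s : ℝ) ^ 2 * Real.exp (-∑' p, |x p n| ^ q) ≤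
      (∑' n : S → ℤ, Real.exp (-∑' p, |x p n| ^ q)) *
        ∫ ω, (∑' n : S → ℤ, (n s : ℝ) ^ 2 * Real.exp (-∑' p, X p ω * x p n ^ 2)) /
          ∑' n : S → ℤ, Real.exp (-∑' p, X p ω * x p n ^ 2) ∂P := by
  have hK : K ≠ ⊤ := ne_top_of_isProbabilityMeasure_tiltedMixing (μ := μ)
  have hXpos : ∀ᵐ ω ∂P, ∀ p, 0 < X p ω := ae_all_iff.2 fun p =>
    ae_of_ae_map (hXm p).aemeasurable (by rw [hlaw p]; exact ae_pos_tiltedMixing hpos)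
  have hXsum : ∀ᵐ ω ∂P, ∀ n, Summable fun p => X p ω * x p n ^ 2 := ae_all_iff.2 fun n =>
    ae_summable_mul_sq hK hpos hmix hXm hlaw hXpos (hx n) (hx2 n)
  have hsq : ∀ n : S → ℤ, |(n s : ℝ) ^ 2| ≤ ∏ s, (1 + (n s : ℝ) ^ 2) := fun n => by
    rw [abs_of_nonneg (sq_nonneg _)]
    exact sq_coord_le_prod n s
  have hone : ∀ n : S → ℤ, |(1 : ℝ)| ≤ ∏ s, (1 + (n s : ℝ) ^ 2) := fun n => by
    rw [abs_one]
    exact one_le_prod_one_add_sq n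
  obtain ⟨a, ha, hge⟩ : ∃ a > 0, ∀ n : S → ℤ,
      a * ∑ s, |(n s : ℝ)| ^ q ≤ ∑ s, |x (e s) n| ^ q := by
    obtain ⟨a, ha, hle⟩ := exists_pos_mul_sum_le fun s => Real.rpow_pos_of_pos (hc s) q
    refine ⟨a, ha, fun n => (hle _ fun s => by positivity).trans_eq
      (Finset.sum_congr rfl fun s _ => ?_)⟩
    rw [hxe, abs_mul, abs_of_pos (hc s), Real.mul_rpow (hc s).le (abs_nonneg _)]
  -- the network restricted to finitely many edges
  let xF : (F : Finset E) → F → (S → ℤ) →+ ℝ := fun F p => x p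
  let XF : (F : Finset E) → Ω → F → ℝ := fun F ω p => X p ω
  have hXF : ∀ F, Measurable (XF F) := fun F => measurable_pi_lambda _ fun p => hXm p
  have hedge : ∀ F ω n, edgeForm (xF F) (XF F ω) n = ∑ p ∈ F, X p ω * x p n ^ 2 := fun F ω n =>
    Finset.sum_coe_sort F fun p => X p ω * x p n ^ 2
  let V : Finset E → Ω → ℝ := fun F ω =>
    (edgeMoment (xF F) s (XF F ω) / edgeZ (xF F) (XF F ω)).toReal
  have hemb : ∀ {F : Finset E}, Finset.univ.map e ≤ F →
      ∃ eF : S ↪ F, ∀ s, (eF s : E) = e s := fun {F} hF =>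
    ⟨⟨fun s => ⟨e s, hF (Finset.mem_map_of_mem e (Finset.mem_univ s))⟩,
      fun a b h => e.injective (congrArg Subtype.val h)⟩, fun _ => rfl⟩
  have hcoer : ∀ {F : Finset E}, Finset.univ.map e ≤ F → ∀ l : F → ℝ, (∀ p, 0 < l p) →
      IsCoerciveForm (edgeForm (xF F) l) := by
    intro F hF l hl
    obtain ⟨eF, heF⟩ := hemb hF
    exact isCoerciveForm_edgeForm (e := eF) hc (fun s n => by simp only [xF, heF, hxe]) hl
  have hVeq : ∀ {F : Finset E}, Finset.univ.map e ≤ F → ∀ {ω}, (∀ p, 0 < X p ω) →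
      edgeMoment (xF F) s (XF F ω) / edgeZ (xF F) (XF F ω) = ENNReal.ofReal
        ((∑' n : S → ℤ, (n s : ℝ) ^ 2 * Real.exp (-∑ p ∈ F, X p ω * x p n ^ 2)) /
          ∑' n : S → ℤ, Real.exp (-∑ p ∈ F, X p ω * x p n ^ 2)) := by
    intro F hF ω hω
    have h := hcoer hF (XF F ω) fun p => hω p
    rw [edgeMoment_eq h, edgeZ_eq h, ← ENNReal.ofReal_div_of_pos h.tsum_exp_neg_pos]
    simp only [hedge]
  have hVle : ∀ {F : Finset E}, Finset.univ.map e ≤ F → ∀ {ω}, (∀ p, 0 < X p ω) →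
      edgeMoment (xF F) s (XF F ω) / edgeZ (xF F) (XF F ω) ≤
        ENNReal.ofReal (4 / c s ^ 2 * (X (e s) ω)⁻¹) := by
    intro F hF ω hω
    obtain ⟨eF, heF⟩ := hemb hF
    have h := hcoer hF (XF F ω) fun p => hω p
    have h4 := mul_tsum_sq_mul_exp_neg_edgeForm_le (x := xF F) (e := eF) (l := XF F ω) hc
      (fun s n => by simp only [xF, heF, hxe]) (fun p => hω p) s
    have hXe : XF F ω (eF s) = X (e s) ω := by simp only [XF, heF]
    rw [hXe] at h4
    rw [hVeq hF hω]
    refine ENNReal.ofReal_le_ofReal ?_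
    have hZ := h.tsum_exp_neg_pos
    simp only [hedge] at h4 hZ
    have h0 := hω (e s)
    have h1 := hc s
    rw [div_le_iff₀ hZ, div_mul_eq_mul_div, ← div_eq_mul_inv, div_div,
      div_mul_eq_mul_div, le_div_iff₀ (by positivity)]
    linarith
  have hbound : ∫⁻ ω, ENNReal.ofReal (4 / c s ^ 2 * (X (e s) ω)⁻¹) ∂P < ⊤ := by
    have h := lintegral_inv_tiltedMixing_lt_top hq hK hpos hmix
    rw [← hlaw (e s), lintegral_map (by fun_prop) (hXm _)] at h
    have h4 : (0 : ℝ) ≤ 4 / c s ^ 2 := by positivity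
    simp only [ENNReal.ofReal_mul h4]
    have hm := hXm (e s)
    rw [lintegral_const_mul _ (by fun_prop)]
    exact ENNReal.mul_lt_top ENNReal.ofReal_lt_top h
  have hVm : ∀ F, Measurable fun ω => edgeMoment (xF F) s (XF F ω) / edgeZ (xF F) (XF F ω) :=
    fun F => ((measurable_edgeMoment s).comp (hXF F)).div (measurable_edgeZ.comp (hXF F))
  have hfinite : ∀ {F : Finset E}, Finset.univ.map e ≤ F →
      ∑' n : S → ℤ, (n s : ℝ) ^ 2 * Real.exp (-∑ p ∈ F, |x p n| ^ q) ≤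
        (∑' n : S → ℤ, 1 * Real.exp (-∑ p ∈ F, |x p n| ^ q)) * ∫ ω, V F ω ∂P := by
    intro F hF
    have h := tsum_moment_le_tsum_mul_lintegral hpos hmix (X := fun p : F => X p)
      (fun p => hXm p) (hX.precomp Subtype.val_injective) (fun p => hlaw p) (hcoer hF) s
    have hE : ∀ n, ∑ p : F, |xF F p n| ^ q = ∑ p ∈ F, |x p n| ^ q := fun n =>
      Finset.sum_coe_sort F fun p => |x p n| ^ q
    have hge' : ∀ n : S → ℤ, a * ∑ s, |(n s : ℝ)| ^ q ≤ ∑ p ∈ F, |x p n| ^ q := fun n => by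
      refine (hge n).trans ?_
      rw [← Finset.sum_map Finset.univ e fun p => |x p n| ^ q]
      exact Finset.sum_le_sum_of_subset_of_nonneg hF fun p _ _ => by positivity
    have hI : ∫⁻ ω, edgeMoment (xF F) s (XF F ω) / edgeZ (xF F) (XF F ω) ∂P < ⊤ :=
      lt_of_le_of_lt (lintegral_mono_ae (hXpos.mono fun ω hω => hVle hF hω)) hbound
    have hIV : ∫ ω, V F ω ∂P =
        (∫⁻ ω, edgeMoment (xF F) s (XF F ω) / edgeZ (xF F) (XF F ω) ∂P).toReal :=
      integral_toReal (hVm F).aemeasurable (ae_lt_top (hVm F) hI.ne)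
    have hZ0 : 0 ≤ ∑' n : S → ℤ, Real.exp (-∑ p ∈ F, |x p n| ^ q) :=
      tsum_nonneg fun _ => (Real.exp_pos _).le
    simp only [hE] at h
    rw [← ENNReal.ofReal_tsum_of_nonneg (fun _ => by positivity)
        (summable_mul_exp_neg_of_le ha hq hge' hsq),
      ← ENNReal.ofReal_tsum_of_nonneg (fun _ => by positivity)
        (by simpa only [one_mul] using summable_mul_exp_neg_of_le ha hq hge' hone)] at h
    rw [hIV]
    simp only [one_mul]
    rw [← ENNReal.ofReal_le_ofReal_iff (mul_nonneg hZ0 ENNReal.toReal_nonneg),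
      ENNReal.ofReal_mul hZ0, ENNReal.ofReal_toReal hI.ne]
    exact h
  have hge_F : ∀ᶠ F : Finset E in atTop, Finset.univ.map e ≤ F := eventually_ge_atTop _
  have hA := tendsto_tsum_mul_exp_neg_sum (fun p n => by positivity) hx ha hq hge hsq
  have hZ := tendsto_tsum_mul_exp_neg_sum (fun p n => by positivity) hx ha hq hge hone
  have hV : Tendsto (fun F => ∫ ω, V F ω ∂P) atTop
      (𝓝 (∫ ω, (∑' n : S → ℤ, (n s : ℝ) ^ 2 * Real.exp (-∑' p, X p ω * x p n ^ 2)) /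
          ∑' n : S → ℤ, Real.exp (-∑' p, X p ω * x p n ^ 2) ∂P)) := by
    refine tendsto_integral_filter_of_dominated_convergence
      (fun ω => 4 / c s ^ 2 * (X (e s) ω)⁻¹)
      (Eventually.of_forall fun F => (hVm F).ennreal_toReal.aestronglyMeasurable) ?_ ?_ ?_
    · filter_upwards [hge_F] with F hF
      filter_upwards [hXpos] with ω hω
      have h0 : 0 ≤ 4 / c s ^ 2 * (X (e s) ω)⁻¹ :=
        mul_nonneg (by positivity) (inv_nonneg.2 (hω _).le)
      rw [Real.norm_of_nonneg ENNReal.toReal_nonneg]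
      exact ENNReal.toReal_le_of_le_ofReal h0 (hVle hF hω)
    · have hm := hXm (e s)
      refine ⟨by fun_prop, ?_⟩
      rw [hasFiniteIntegral_iff_ofReal]
      · exact hbound
      · filter_upwards [hXpos] with ω hω
        exact mul_nonneg (by positivity) (inv_nonneg.2 (hω _).le)
    · filter_upwards [hXpos, hXsum] with ω hω hωsum
      obtain ⟨b, hb, hbge⟩ := exists_pos_mul_sum_le fun s =>
        mul_pos (hω (e s)) (pow_pos (hc s) 2)
      have hge2 : ∀ n : S → ℤ, b * ∑ s, |(n s : ℝ)| ^ (2 : ℝ) ≤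
          ∑ s, X (e s) ω * x (e s) n ^ 2 := fun n => by
        refine (hbge _ fun s => by positivity).trans_eq (Finset.sum_congr rfl fun s _ => ?_)
        rw [hxe, mul_pow, Real.rpow_two, sq_abs, mul_assoc]
      have hnn : ∀ p (n : S → ℤ), 0 ≤ X p ω * x p n ^ 2 := fun p n =>
        mul_nonneg (hω p).le (sq_nonneg _)
      have h1 := tendsto_tsum_mul_exp_neg_sum hnn hωsum hb two_pos hge2 hsq
      have h2 := tendsto_tsum_mul_exp_neg_sum hnn hωsum hb two_pos hge2 hone
      simp only [one_mul] at h2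
      have hne : (∑' n : S → ℤ, Real.exp (-∑' p, X p ω * x p n ^ 2)) ≠ 0 := by
        have hs : Summable fun n : S → ℤ => Real.exp (-∑' p, X p ω * x p n ^ 2) := by
          have h := summable_mul_exp_neg_of_le hb two_pos
            (fun n => (hge2 n).trans (sum_emb_le_tsum (hnn · n) (hωsum n) e)) hone
          simpa only [one_mul] using h
        exact (hs.tsum_pos (fun _ => (Real.exp_pos _).le) 0 (Real.exp_pos _)).ne'
      refine (h1.div h2 hne).congr' ?_
      filter_upwards [hge_F] with F hF
      simp only [V]
      rw [hVeq hF hω, ENNReal.toReal_ofReal (div_nonneg (tsum_nonneg fun _ => by positivity)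
        (tsum_nonneg fun _ => by positivity))]
      rfl
  have hfin := le_of_tendsto_of_tendsto hA (hZ.mul hV) (hge_F.mono fun F hF => hfinite hF)
  simpa only [one_mul] using hfin

end InfiniteNetwork

section Chain

/-- The extension by zero of a height function on `B` to `ℤ`. -/
def zeroExtend (B : Finset ℤ) (n : B → ℤ) (k : ℤ) : ℤ :=
  if h : k ∈ B then n ⟨k, h⟩ else 0

theorem zeroExtend_of_mem {B : Finset ℤ} (n : B → ℤ) {k : ℤ} (h : k ∈ B) :
    zeroExtend B n k = n ⟨k, h⟩ :=
  dif_pos h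

theorem zeroExtend_of_notMem {B : Finset ℤ} (n : B → ℤ) {k : ℤ} (h : k ∉ B) :
    zeroExtend B n k = 0 :=
  dif_neg h

theorem zeroExtend_add {B : Finset ℤ} (n m : B → ℤ) (k : ℤ) :
    zeroExtend B (n + m) k = zeroExtend B n k + zeroExtend B m k := by
  unfold zeroExtend
  split_ifs <;> simp

/-- The sites `{-N, …, N}` of the chain of length `N`. -/
noncomputable def chainSites (N : ℕ) : Finset ℤ :=
  Finset.Icc (-(N : ℤ)) N

theorem mem_chainSites {N : ℕ} {k : ℤ} : k ∈ chainSites N ↔ |k| ≤ N := by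
  rw [chainSites, Finset.mem_Icc, abs_le]

/-- A configuration of the chain is determined by its heights on the sites of the chain. -/
noncomputable def chainConfigEquiv (N : ℕ) : (chainSites N → ℤ) ≃ ChainConfig N where
  toFun n := ⟨zeroExtend _ n, fun k hk => zeroExtend_of_notMem n fun h =>
    hk.not_ge (mem_chainSites.1 h)⟩
  invFun φ s := φ.val s
  left_inv n := funext fun s => zeroExtend_of_mem n s.2
  right_inv φ := Subtype.ext <| funext fun k => by
    change zeroExtend (chainSites N) (fun s => φ.val s) k = φ.val k
    by_cases h : k ∈ chainSites N
    · exact zeroExtend_of_mem _ h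
    · rw [zeroExtend_of_notMem _ h, φ.2 k]
      rwa [← not_le, ← mem_chainSites]

/-- The gradient `(i, j) ↦ (β / |i - j|^α)^{1/q} (φ(i) - φ(j))`, as a function of the heights
in `B`. -/
noncomputable def chainGradient (β α q : ℝ) (B : Finset ℤ) (p : ℤ × ℤ) : (B → ℤ) →+ ℝ :=
  AddMonoidHom.mk'
    (fun n => (β / |((p.1 - p.2 : ℤ) : ℝ)| ^ α) ^ (1 / q) *
      ((zeroExtend B n p.1 - zeroExtend B n p.2 : ℤ) : ℝ))
    fun n m => by
      simp only [zeroExtend_add]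
      push_cast
      ring

theorem chainGradient_apply (β α q : ℝ) (B : Finset ℤ) (p : ℤ × ℤ) (n : B → ℤ) :
    chainGradient β α q B p n = (β / |((p.1 - p.2 : ℤ) : ℝ)| ^ α) ^ (1 / q) *
      ((zeroExtend B n p.1 - zeroExtend B n p.2 : ℤ) : ℝ) :=
  rfl

theorem summable_rpow_sub_div {φ : ℤ → ℤ} (hφ : φ.HasFiniteSupport) {q α : ℝ} (hq : 0 < q)
    (hα : 1 < α) :
    Summable fun p : ℤ × ℤ =>
      |((φ p.1 - φ p.2 : ℤ) : ℝ)| ^ q / |((p.1 - p.2 : ℤ) : ℝ)| ^ α := by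
  have hv : Summable fun k => |(φ k : ℝ)| ^ q := by
    refine summable_of_hasFiniteSupport (hφ.subset fun k hk => ?_)
    rw [Function.mem_support] at hk ⊢
    contrapose! hk
    rw [hk, Int.cast_zero, abs_zero, Real.zero_rpow hq.ne']
  have hw := Real.summable_abs_int_rpow hα
  have hvw := hv.mul_of_nonneg hw (fun _ => by positivity) fun _ => by positivity
  have h1 : Summable fun p : ℤ × ℤ => |(φ p.1 : ℝ)| ^ q * |((p.1 - p.2 : ℤ) : ℝ)| ^ (-α) :=
    (Function.Involutive.toPerm (fun p : ℤ × ℤ => (p.1, p.1 - p.2))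
      fun p => Prod.ext rfl (sub_sub_cancel _ _)).summable_iff.2 hvw
  have h2 : Summable fun p : ℤ × ℤ => |(φ p.2 : ℝ)| ^ q * |((p.1 - p.2 : ℤ) : ℝ)| ^ (-α) := by
    refine ((Equiv.prodComm ℤ ℤ).summable_iff.2 h1).congr fun p => ?_
    simp only [Function.comp_apply, Equiv.prodComm_apply, Prod.fst_swap, Prod.snd_swap]
    rw [← neg_sub p.1 p.2, Int.cast_neg, abs_neg]
  refine ((h1.add h2).mul_left (2 ^ q)).of_nonneg_of_le (fun p => by positivity) fun p => ?_
  rw [div_eq_mul_inv, ← Real.rpow_neg (abs_nonneg _), ← add_mul, ← mul_assoc]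
  gcongr
  have h : ∀ a b : ℝ, |b| ≤ |a| → |a - b| ^ q ≤ 2 ^ q * (|a| ^ q + |b| ^ q) := fun a b hab =>
    calc |a - b| ^ q ≤ (2 * |a|) ^ q := by
          gcongr
          linarith [abs_sub a b]
      _ = 2 ^ q * |a| ^ q := Real.mul_rpow zero_le_two (abs_nonneg _)
      _ ≤ 2 ^ q * (|a| ^ q + |b| ^ q) := by
          gcongr
          exact le_add_of_nonneg_right (by positivity)
  push_cast
  rcases le_total |(φ p.2 : ℝ)| |(φ p.1 : ℝ)| with hab | hab
  · exact h _ _ hab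
  · rw [abs_sub_comm, add_comm]
    exact h _ _ hab

theorem hasFiniteSupport_zeroExtend {B : Finset ℤ} (n : B → ℤ) :
    (zeroExtend B n).HasFiniteSupport :=
  B.finite_toSet.subset fun k hk => by
    by_contra h
    exact hk (zeroExtend_of_notMem n h)

variable {β α q : ℝ} {B : Finset ℤ}

theorem abs_chainGradient_rpow (hβ : 0 < β) (hq : 0 < q) (p : ℤ × ℤ) (n : B → ℤ) :
    |chainGradient β α q B p n| ^ q =
      β * (|((zeroExtend B n p.1 - zeroExtend B n p.2 : ℤ) : ℝ)| ^ q /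
        |((p.1 - p.2 : ℤ) : ℝ)| ^ α) := by
  rw [chainGradient_apply, abs_mul, abs_of_nonneg (by positivity),
    Real.mul_rpow (by positivity) (abs_nonneg _), ← Real.rpow_mul (by positivity),
    one_div_mul_cancel hq.ne', Real.rpow_one]
  ring

theorem chainGradient_sq (hβ : 0 < β) (p : ℤ × ℤ) (n : B → ℤ) :
    chainGradient β α q B p n ^ 2 =
      β ^ (2 / q) * (((zeroExtend B n p.1 - zeroExtend B n p.2 : ℤ) : ℝ) ^ 2 /
        |((p.1 - p.2 : ℤ) : ℝ)| ^ (2 * α / q)) := by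
  rw [chainGradient_apply, mul_pow, ← Real.rpow_mul_natCast (by positivity),
    Real.div_rpow hβ.le (by positivity), ← Real.rpow_mul (abs_nonneg _), Nat.cast_ofNat,
    one_div_mul_eq_div, mul_div_left_comm, ← mul_div_assoc]
  ring

theorem chainEnergy_zeroExtend (hβ : 0 < β) (hq : 0 < q) (n : B → ℤ) :
    chainEnergy β α q (zeroExtend B n) = ∑' p, |chainGradient β α q B p n| ^ q := by
  simp only [chainEnergy, abs_chainGradient_rpow hβ hq, tsum_mul_left]
  congr 1
  refine tsum_congr fun p => ?_
  split_ifs with h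
  · rw [h, sub_self, Int.cast_zero, abs_zero, Real.zero_rpow hq.ne', zero_div]
  · rfl

theorem qchainEnergy_zeroExtend (hβ : 0 < β) (lam : ℤ × ℤ → ℝ) (n : B → ℤ) :
    qchainEnergy (β ^ (2 / q)) (2 * α / q) lam (zeroExtend B n) =
      ∑' p, lam p * chainGradient β α q B p n ^ 2 := by
  simp only [qchainEnergy, chainGradient_sq hβ, mul_left_comm (lam _), tsum_mul_left]
  congr 1
  refine tsum_congr fun p => ?_
  split_ifs with h
  · rw [h, sub_self, Int.cast_zero, zero_pow two_ne_zero, zero_div, mul_zero]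
  · rw [mul_div_assoc]

theorem summable_abs_chainGradient_rpow (hβ : 0 < β) (hq : 0 < q) (hα : 1 < α) (n : B → ℤ) :
    Summable fun p => |chainGradient β α q B p n| ^ q := by
  simp only [abs_chainGradient_rpow hβ hq]
  exact (summable_rpow_sub_div (hasFiniteSupport_zeroExtend n) hq hα).mul_left β

theorem summable_chainGradient_sq (hβ : 0 < β) (hα : 1 < 2 * α / q) (n : B → ℤ) :
    Summable fun p => chainGradient β α q B p n ^ 2 := by
  simp only [chainGradient_sq hβ]
  have h := summable_rpow_sub_div (hasFiniteSupport_zeroExtend n) two_pos hα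
  simp only [Real.rpow_two, sq_abs] at h
  exact h.mul_left _

theorem qchainEnergy_neg (β α : ℝ) (lam : ℤ × ℤ → ℝ) (φ : ℤ → ℤ) :
    qchainEnergy β α lam (-φ) = qchainEnergy β α lam φ := by
  unfold qchainEnergy
  congr 1
  refine tsum_congr fun p => ?_
  rw [Pi.neg_apply, Pi.neg_apply, ← neg_sub_neg, neg_neg, neg_neg, ← neg_sub (φ p.1), Int.cast_neg,
    neg_sq]

theorem qchainMean_eq_zero (N : ℕ) (β α : ℝ) (lam : ℤ × ℤ → ℝ) : qchainMean N β α lam = 0 := by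
  let σ : ChainConfig N ≃ ChainConfig N := Function.Involutive.toPerm
    (fun φ => ⟨-φ.val, fun k hk => by rw [Pi.neg_apply, φ.2 k hk, neg_zero]⟩)
    fun φ => Subtype.ext (neg_neg φ.val)
  have h : ∑' φ : ChainConfig N, ((φ.val 0 : ℤ) : ℝ) * qchainWeight β α lam φ.val =
      -∑' φ : ChainConfig N, ((φ.val 0 : ℤ) : ℝ) * qchainWeight β α lam φ.val := by
    rw [← tsum_neg, ← σ.tsum_eq]
    refine tsum_congr fun φ => ?_
    change (((-φ.val) 0 : ℤ) : ℝ) * qchainWeight β α lam (-φ.val) = _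
    rw [qchainWeight, qchainEnergy_neg, ← qchainWeight, Pi.neg_apply, Int.cast_neg, neg_mul]
  rw [qchainMean, self_eq_neg.1 h, zero_div]

end Chain

open MeasureTheory

/-- **Domination of the `q`-SOS chain from above by an annealed Gaussian chain with
i.i.d. random conductances.** Fix `q ∈ (0,2)`, `β ∈ (0,∞)`, `α ∈ (1,∞)`, and set
`β_q := β^{2/q}` and `α_q := 2α/q`. Let `μ_q` be the Gaussian mixing measure of the
potential `e^{−|x|^q}`, let `μ̃_q` be the tilted measure
`dμ̃_q(λ) = λ^{−1/2} dμ_q(λ) / ∫ λ^{−1/2} dμ_q(λ)`, and let `P` be the law of i.i.d.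
conductances `(λ_{ij})_{i,j∈ℤ}` with marginal `μ̃_q`. Then for every `N ≥ 1`,
`Var^{q-SOS}_{N,β,α}[φ(0)] ≤ Ẽ_q[Var^λ_{N,β_q,α_q}[φ(0)]]`. -/
theorem qSOS_dominated_by_annealed_gaussian_chain
    (q : ℝ) (hq₀ : 0 < q) (hq₂ : q < 2)
    (β : ℝ) (hβ : 0 < β) (α : ℝ) (hα : 1 < α)
    (μq : Measure ℝ) (hμprob : IsProbabilityMeasure μq)
    (hμsupp : μq {l : ℝ | l ≤ 0} = 0)
    (hμmix : ∀ x : ℝ, Real.exp (-(|x| ^ q)) = ∫ l, Real.exp (-(l * x ^ 2)) ∂μq)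
    (P : Measure ((ℤ × ℤ) → ℝ)) (hPprob : IsProbabilityMeasure P)
    (hPindep : ProbabilityTheory.iIndepFun
      (m := fun _ : ℤ × ℤ => (inferInstance : MeasurableSpace ℝ)) (fun ij ω => ω ij) P)
    (hPmarg : ∀ ij : ℤ × ℤ,
      P.map (fun ω => ω ij) =
        (ENNReal.ofReal (∫ l, l ^ (-(1 : ℝ) / 2) ∂μq))⁻¹ •
          μq.withDensity (fun l => ENNReal.ofReal (l ^ (-(1 : ℝ) / 2))))
    (N : ℕ) (hN : 1 ≤ N) :
    chainVar N β α q ≤ ∫ lam, qchainVar N (β ^ ((2 : ℝ) / q)) (2 * α / q) lam ∂P := by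
  have hpos : ∀ᵐ l ∂μq, 0 < l := by
    rw [ae_iff]
    simpa only [not_lt] using hμsupp
  have : IsProbabilityMeasure
      (tiltedMixing (ENNReal.ofReal (∫ l, l ^ (-(1 : ℝ) / 2) ∂μq))⁻¹ μq) := by
    rw [tiltedMixing, ← hPmarg 0]
    exact Measure.isProbabilityMeasure_map (measurable_pi_apply 0).aemeasurable
  have hα' : 1 < 2 * α / q := by
    rw [one_lt_div hq₀]
    linarith
  have h0 : (0 : ℤ) ∈ chainSites N := by simp [mem_chainSites]
  have hB : ∀ s : chainSites N, (s : ℤ) - (N + 1) ≠ 0 := fun s => by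
    have := le_of_abs_le (mem_chainSites.1 s.2)
    lia
  let e : chainSites N ↪ ℤ × ℤ :=
    ⟨fun s => (s, N + 1), fun s t h => Subtype.ext (congrArg Prod.fst h)⟩
  have hc : ∀ s : chainSites N, 0 < (β / |(((s : ℤ) - (N + 1) : ℤ) : ℝ)| ^ α) ^ (1 / q) :=
    fun s => Real.rpow_pos_of_pos (div_pos hβ (Real.rpow_pos_of_pos
      (abs_pos.2 (Int.cast_ne_zero.2 (hB s))) α)) _
  have hxe : ∀ (s : chainSites N) n, chainGradient β α q (chainSites N) (e s) n =
      (β / |(((s : ℤ) - (N + 1) : ℤ) : ℝ)| ^ α) ^ (1 / q) * (n s : ℝ) := fun s n => by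
    have hN1 : (N + 1 : ℤ) ∉ chainSites N := fun h => by
      have := le_of_abs_le (mem_chainSites.1 h)
      lia
    rw [chainGradient_apply]
    change _ * ((zeroExtend (chainSites N) n s - zeroExtend (chainSites N) n (N + 1) : ℤ) : ℝ) = _
    rw [zeroExtend_of_mem n s.2, zeroExtend_of_notMem n hN1, sub_zero]
    rfl
  have key := tsum_moment_le_tsum_mul_integral hq₀ hpos hμmix
    (fun p => measurable_pi_apply p) hPindep hPmarg hc hxe
    (summable_abs_chainGradient_rpow hβ hq₀ hα) (summable_chainGradient_sq hβ hα') ⟨0, h0⟩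
  have hval : ∀ n, (chainConfigEquiv N n).val = zeroExtend (chainSites N) n := fun _ => rfl
  have hZ : chainZ N β α q =
      ∑' n : chainSites N → ℤ, Real.exp (-∑' p, |chainGradient β α q (chainSites N) p n| ^ q) := by
    rw [chainZ, ← (chainConfigEquiv N).tsum_eq]
    simp only [hval, chainWeight, chainEnergy_zeroExtend hβ hq₀]
  have hA : ∑' φ : ChainConfig N, ((φ.val 0 : ℤ) : ℝ) ^ 2 * chainWeight β α q φ.val =
      ∑' n : chainSites N → ℤ, (n ⟨0, h0⟩ : ℝ) ^ 2 *
        Real.exp (-∑' p, |chainGradient β α q (chainSites N) p n| ^ q) := by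
    rw [← (chainConfigEquiv N).tsum_eq]
    simp only [hval, chainWeight, chainEnergy_zeroExtend hβ hq₀, zeroExtend_of_mem _ h0]
  have hV : ∀ lam, qchainVar N (β ^ ((2 : ℝ) / q)) (2 * α / q) lam =
      (∑' n : chainSites N → ℤ, (n ⟨0, h0⟩ : ℝ) ^ 2 *
        Real.exp (-∑' p, lam p * chainGradient β α q (chainSites N) p n ^ 2)) /
      ∑' n : chainSites N → ℤ,
        Real.exp (-∑' p, lam p * chainGradient β α q (chainSites N) p n ^ 2) := by
    intro lam
    rw [qchainVar, qchainMean_eq_zero, zero_pow two_ne_zero, sub_zero, qchainZ,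
      ← (chainConfigEquiv N).tsum_eq, ← (chainConfigEquiv N).tsum_eq]
    simp only [hval, qchainWeight, qchainEnergy_zeroExtend hβ, zeroExtend_of_mem _ h0]
  simp only [← hV] at key
  rw [← hZ, ← hA] at key
  have hint : 0 ≤ ∫ lam, qchainVar N (β ^ ((2 : ℝ) / q)) (2 * α / q) lam ∂P :=
    integral_nonneg fun lam => by
      rw [Pi.zero_apply, hV]
      exact div_nonneg (tsum_nonneg fun _ => by positivity) (tsum_nonneg fun _ => by positivity)
  have hZ0 : 0 ≤ chainZ N β α q := tsum_nonneg fun _ => (Real.exp_pos _).le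
  calc chainVar N β α q
      ≤ (∑' φ : ChainConfig N, ((φ.val 0 : ℤ) : ℝ) ^ 2 * chainWeight β α q φ.val) /
          chainZ N β α q := sub_le_self _ (sq_nonneg _)
    _ ≤ _ := div_le_of_le_mul₀ hZ0 hint (by rwa [mul_comm] at key)
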